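/- arXiv:2309.05356 — 11 statements merged into one kernel-verified Lean document; each statement's English description precedes it below -/
import Mathlib

section
/- For two finite simple graphs G and H on disjoint vertex sets, the number of 1-nearly independent vertex subsets of their disjoint union satisfies σ₁(G ∪ H) = σ₁(G)·σ₀(H) + σ₀(G)·σ₁(H). -/
/-- The set of edges of `G` whose endpoints all lie in `S`, i.e. the edges of the
subgraph induced on `S`. -/
def edgesWithin {V : Type*} (G : SimpleGraph V) (S : Set V) : Set (Sym2 V) :=
  {e | e ∈ G.edgeSet ∧ ∀ v ∈ e, v ∈ S}

/-- `sigma1 G` is the number of 1-nearly independent vertex subsets of `G`: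
subsets of the vertex set whose induced subgraph has exactly one edge. -/
noncomputable def sigma1 {V : Type*} (G : SimpleGraph V) : ℕ :=
  Nat.card {S : Set V | (edgesWithin G S).ncard = 1}

/-- `sigma0 G` is the number of independent vertex subsets of `G`:
subsets of the vertex set containing no pair of adjacent vertices. -/
noncomputable def sigma0 {V : Type*} (G : SimpleGraph V) : ℕ :=
  Nat.card {S : Set V | edgesWithin G S = ∅}

/-- The edges of a disjoint sum lying within `S` are those of the two summands lying within the
corresponding parts of `S`. -/
theorem edgesWithin_sum {α β : Type*} (G : SimpleGraph α) (H : SimpleGraph β) (S : Set (α ⊕ β)) :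
    edgesWithin (G ⊕g H) S =
      Sym2.map Sum.inl '' edgesWithin G (Sum.inl ⁻¹' S) ∪
        Sym2.map Sum.inr '' edgesWithin H (Sum.inr ⁻¹' S) := by
  ext e
  constructor
  · induction e with | _ x y
    rintro ⟨he, hS⟩
    rw [SimpleGraph.mem_edgeSet] at he
    rcases x with a | b <;> rcases y with a' | b'
    · exact Or.inl ⟨s(a, a'), ⟨by simpa using he, by simpa using hS⟩, rfl⟩
    · simp at he
    · simp at he
    · exact Or.inr ⟨s(b, b'), ⟨by simpa using he, by simpa using hS⟩, rfl⟩
  · rintro (⟨e, he, rfl⟩ | ⟨e, he, rfl⟩) <;> induction e with | _ x y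
    all_goals simp_all [edgesWithin]

theorem ncard_edgesWithin_sum {α β : Type*} [Finite α] [Finite β]
    (G : SimpleGraph α) (H : SimpleGraph β) (S : Set (α ⊕ β)) :
    (edgesWithin (G ⊕g H) S).ncard =
      (edgesWithin G (Sum.inl ⁻¹' S)).ncard + (edgesWithin H (Sum.inr ⁻¹' S)).ncard := by
  rw [edgesWithin_sum, Set.ncard_union_eq _ (Set.toFinite _) (Set.toFinite _),
    Set.ncard_image_of_injective _ (Sym2.map.injective Sum.inl_injective),
    Set.ncard_image_of_injective _ (Sym2.map.injective Sum.inr_injective)]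
  rw [Set.disjoint_left]
  rintro _ ⟨e, -, rfl⟩ ⟨f, -, hf⟩
  induction e with | _ x y
  induction f with | _ z w
  simp at hf

/-- For finite simple graphs `G` and `H` on disjoint vertex sets, the number of 1-nearly
independent vertex subsets of their disjoint union satisfies
`σ₁(G ∪ H) = σ₁(G)·σ₀(H) + σ₀(G)·σ₁(H)`. -/
theorem sigma1_disjoint_union {α β : Type*} [Fintype α] [Fintype β]
    (G : SimpleGraph α) (H : SimpleGraph β) :
    sigma1 (G ⊕g H) = sigma1 G * sigma0 H + sigma0 G * sigma1 H := by
  simp only [sigma1, sigma0, Nat.card_coe_set_eq]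
  have preimage_eq : {S | (edgesWithin (G ⊕g H) S).ncard = 1} =
      Set.sumEquiv ⁻¹'
        ({S | (edgesWithin G S).ncard = 1} ×ˢ {S | edgesWithin H S = ∅} ∪
          {S | edgesWithin G S = ∅} ×ˢ {S | (edgesWithin H S).ncard = 1}) := by
    ext S
    simp only [Set.mem_ofPred_eq, Set.mem_preimage, Set.mem_union, Set.mem_prod, Set.sumEquiv_apply,
      ncard_edgesWithin_sum, ← Set.ncard_eq_zero (Set.toFinite (edgesWithin G _)),
      ← Set.ncard_eq_zero (Set.toFinite (edgesWithin H _))]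
    omega
  rw [preimage_eq, Set.ncard_preimage_of_injective_subset_range Set.sumEquiv.injective
    (by simp [Set.sumEquiv.surjective.range_eq]),
    Set.ncard_union_eq _ (Set.toFinite _) (Set.toFinite _), Set.ncard_prod, Set.ncard_prod]
  rw [Set.disjoint_left]
  rintro ⟨S, T⟩ ⟨hS, -⟩ ⟨hS', -⟩
  simp_all
end

section
/- For any vertex v of a finite simple graph G, σ₁(G) = σ₁(G − v) + σ₁(G − N[v]) + Σ_{u ∈ N(v)} σ₀(G − (N[u] ∪ N[v])), where N(v) is the open neighbourhood of v, N[v] = N(v) ∪ {v} is the closed neighbourhood, and G − S denotes the subgraph induced on the complement of the vertex set S. -/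
open scoped Classical

/-- The closed neighbourhood `N[v]` of a vertex. -/
def closedNbhd {V : Type*} (G : SimpleGraph V) (v : V) : Set V :=
  insert v (G.neighborSet v)

theorem edgesWithin_image_val {V : Type*} (G : SimpleGraph V) (s : Set V) (T : Set s) :
    edgesWithin G (Subtype.val '' T) = Sym2.map Subtype.val '' edgesWithin (G.induce s) T := by
  ext e
  constructor
  · induction e with | h a b => ?_
    rintro ⟨he, hT⟩
    obtain ⟨a, ha, rfl⟩ := hT a (Sym2.mem_mk_left a b)
    obtain ⟨b, hb, rfl⟩ := hT _ (Sym2.mem_mk_right _ b)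
    refine ⟨s(a, b), ⟨by simpa using he, ?_⟩, rfl⟩
    intro w hw
    rcases Sym2.mem_iff.1 hw with rfl | rfl <;> assumption
  · rintro ⟨e, ⟨he, hT⟩, rfl⟩
    induction e with | h a b => ?_
    refine ⟨by simpa using he, ?_⟩
    intro w hw
    rcases Sym2.mem_iff.1 hw with rfl | rfl
    · exact ⟨a, hT a (Sym2.mem_mk_left a b), rfl⟩
    · exact ⟨b, hT b (Sym2.mem_mk_right a b), rfl⟩

theorem card_setOf_image_val {V : Type*} (s : Set V) (p : Set V → Prop) :
    Nat.card {T : Set s | p (Subtype.val '' T)} = {S : Set V | S ⊆ s ∧ p S}.ncard := by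
  rw [Nat.card_coe_set_eq,
    ← Set.ncard_image_of_injective _ (Set.image_injective.2 (Subtype.val_injective (p := (· ∈ s))))]
  congr 1
  ext S
  constructor
  · rintro ⟨T, hT, rfl⟩
    exact ⟨Subtype.coe_image_subset s T, hT⟩
  · rintro ⟨hS, hp⟩
    have h : Subtype.val '' ((Subtype.val : s → V) ⁻¹' S) = S := by
      simpa [Subtype.image_preimage_coe] using hS
    exact ⟨_, by simpa only [Set.mem_ofPred_eq, h] using hp, h⟩

theorem sigma1_induce {V : Type*} (G : SimpleGraph V) (s : Set V) :
    sigma1 (G.induce s) = {S : Set V | S ⊆ s ∧ (edgesWithin G S).ncard = 1}.ncard := by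
  rw [← card_setOf_image_val, sigma1]
  simp only [edgesWithin_image_val,
    Set.ncard_image_of_injective _ (Sym2.map.injective Subtype.val_injective)]

theorem sigma0_induce {V : Type*} (G : SimpleGraph V) (s : Set V) :
    sigma0 (G.induce s) = {S : Set V | S ⊆ s ∧ edgesWithin G S = ∅}.ncard := by
  rw [← card_setOf_image_val, sigma0]
  simp only [edgesWithin_image_val, Set.image_eq_empty]

theorem mk_mem_edgesWithin {V : Type*} {G : SimpleGraph V} {S : Set V} {a b : V} :
    s(a, b) ∈ edgesWithin G S ↔ G.Adj a b ∧ a ∈ S ∧ b ∈ S := by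
  simp [edgesWithin]

theorem edgesWithin_eq_empty_iff {V : Type*} {G : SimpleGraph V} {S : Set V} :
    edgesWithin G S = ∅ ↔ ∀ a ∈ S, ∀ b ∈ S, ¬ G.Adj a b := by
  simp only [Set.eq_empty_iff_forall_notMem, Sym2.forall, mk_mem_edgesWithin]
  grind

theorem mem_edgesWithin_insert {V : Type*} {G : SimpleGraph V} {S : Set V} {v : V} {e : Sym2 V} :
    e ∈ edgesWithin G (insert v S) ↔
      e ∈ edgesWithin G S ∨ ∃ u ∈ S, G.Adj v u ∧ e = s(v, u) := by
  induction e with | h a b => ?_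
  simp only [mk_mem_edgesWithin, Set.mem_insert_iff, Sym2.eq_iff]
  constructor
  · rintro ⟨h, rfl | ha, rfl | hb⟩
    · exact (G.loopless.irrefl _ h).elim
    · exact .inr ⟨b, hb, h, .inl ⟨rfl, rfl⟩⟩
    · exact .inr ⟨a, ha, h.symm, .inr ⟨rfl, rfl⟩⟩
    · exact .inl ⟨h, ha, hb⟩
  · rintro (⟨h, ha, hb⟩ | ⟨u, hu, h, ⟨rfl, rfl⟩ | ⟨rfl, rfl⟩⟩)
    · exact ⟨h, .inr ha, .inr hb⟩
    · exact ⟨h, .inl rfl, .inr hu⟩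
    · exact ⟨h.symm, .inr hu, .inl rfl⟩

theorem edgesWithin_insert_of_forall_not_adj {V : Type*} {G : SimpleGraph V} {S : Set V} {v : V}
    (h : ∀ u ∈ S, ¬ G.Adj v u) : edgesWithin G (insert v S) = edgesWithin G S := by
  ext e
  rw [mem_edgesWithin_insert]
  grind

theorem ncard_setOf_mem_forall_not_adj {V : Type*} (G : SimpleGraph V) (v : V) :
    {S : Set V | (edgesWithin G S).ncard = 1 ∧ v ∈ S ∧ ∀ u ∈ S, ¬ G.Adj v u}.ncard =
      sigma1 (G.induce (closedNbhd G v)ᶜ) := by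
  have hinj : Set.InjOn (insert v)
      {S : Set V | S ⊆ (closedNbhd G v)ᶜ ∧ (edgesWithin G S).ncard = 1} := by
    rintro S ⟨hS, -⟩ T ⟨hT, -⟩ h
    have hv : v ∈ closedNbhd G v := Set.mem_insert _ _
    rw [← Set.insert_sdiff_self_of_notMem fun h => hS h hv,
      ← Set.insert_sdiff_self_of_notMem fun h => hT h hv, h]
  rw [sigma1_induce, ← hinj.ncard_image]
  congr 1
  ext S
  constructor
  · rintro ⟨h1, hv, hn⟩
    have hS : insert v (S \ {v}) = S := Set.insert_sdiff_self_of_mem hv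
    refine ⟨S \ {v}, ⟨?_, ?_⟩, hS⟩
    · rintro u ⟨hu, huv⟩ (rfl | h)
      · exact huv rfl
      · exact hn u hu h
    · rwa [← edgesWithin_insert_of_forall_not_adj fun u hu => hn u hu.1, hS]
  · rintro ⟨T, ⟨hT, h1⟩, rfl⟩
    have hn : ∀ u ∈ T, ¬ G.Adj v u := fun u hu h => hT hu (.inr h)
    refine ⟨by rwa [edgesWithin_insert_of_forall_not_adj hn], Set.mem_insert _ _, ?_⟩
    rintro u (rfl | hu)
    · exact G.loopless.irrefl _
    · exact hn u hu

theorem ncard_setOf_mem_mem_of_adj {V : Type*} {G : SimpleGraph V} {v u : V} (huv : G.Adj v u) :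
    {S : Set V | (edgesWithin G S).ncard = 1 ∧ v ∈ S ∧ u ∈ S}.ncard =
      sigma0 (G.induce (closedNbhd G u ∪ closedNbhd G v)ᶜ) := by
  have hne : v ≠ u := huv.ne
  have hinj : Set.InjOn (fun S => insert v (insert u S))
      {S : Set V | S ⊆ (closedNbhd G u ∪ closedNbhd G v)ᶜ ∧ edgesWithin G S = ∅} := by
    rintro S ⟨hS, -⟩ T ⟨hT, -⟩ h
    have hv : v ∈ closedNbhd G u ∪ closedNbhd G v := .inr (Set.mem_insert _ _)
    have hu : u ∈ closedNbhd G u ∪ closedNbhd G v := .inl (Set.mem_insert _ _)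
    ext w
    have hw := Set.ext_iff.1 h w
    simp only [Set.mem_insert_iff] at hw
    have h1 := @hS w
    have h2 := @hT w
    by_cases hwv : w = v
    · subst hwv; exact ⟨fun h => (h1 h hv).elim, fun h => (h2 h hv).elim⟩
    by_cases hwu : w = u
    · subst hwu; exact ⟨fun h => (h1 h hu).elim, fun h => (h2 h hu).elim⟩
    simpa [hwv, hwu] using hw
  rw [sigma0_induce, ← hinj.ncard_image]
  congr 1
  ext S
  constructor
  · rintro ⟨h1, hv, hu⟩
    obtain ⟨e, he⟩ := Set.ncard_eq_one.1 h1
    have hedge : ∀ a ∈ S, ∀ b ∈ S, G.Adj a b → s(a, b) = s(v, u) := by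
      intro a ha b hb hab
      have h2 : s(a, b) ∈ edgesWithin G S := mk_mem_edgesWithin.2 ⟨hab, ha, hb⟩
      have h3 : s(v, u) ∈ edgesWithin G S := mk_mem_edgesWithin.2 ⟨huv, hv, hu⟩
      rw [he] at h2 h3
      exact h2.trans h3.symm
    refine ⟨S \ {v, u}, ⟨?_, ?_⟩, ?_⟩
    · rintro w ⟨hw, hwvu⟩ ((rfl | h) | (rfl | h))
      · exact hwvu (.inr rfl)
      · have := hedge u hu w hw h
        grind [Sym2.eq_iff]
      · exact hwvu (.inl rfl)
      · have := hedge v hv w hw h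
        grind [Sym2.eq_iff]
    · rw [edgesWithin_eq_empty_iff]
      rintro a ⟨ha, hav⟩ b ⟨hb, -⟩ hab
      have := hedge a ha b hb hab
      grind [Sym2.eq_iff]
    · ext w
      simp only [Set.mem_insert_iff, Set.mem_sdiff, Set.mem_singleton_iff]
      grind
  · rintro ⟨T, ⟨hT, h0⟩, rfl⟩
    refine ⟨Set.ncard_eq_one.2 ⟨s(v, u), ?_⟩, Set.mem_insert _ _, .inr (Set.mem_insert _ _)⟩
    have hu : ∀ w ∈ T, ¬ G.Adj u w := fun w hw h => hT hw (.inl (.inr h))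
    have hv : ∀ w ∈ T, ¬ G.Adj v w := fun w hw h => hT hw (.inr (.inr h))
    ext e
    rw [mem_edgesWithin_insert, edgesWithin_insert_of_forall_not_adj hu, h0]
    simp only [Set.mem_empty_iff_false, false_or, Set.mem_insert_iff, Set.mem_singleton_iff]
    grind

/-- For any vertex `v` of a finite simple graph `G`,
`σ₁(G) = σ₁(G − v) + σ₁(G − N[v]) + Σ_{u ∈ N(v)} σ₀(G − (N[u] ∪ N[v]))`,
where `G − S` denotes the subgraph induced on the complement of `S`. -/
theorem sigma1_vertex_recursion {V : Type*} [Fintype V] (G : SimpleGraph V) (v : V) :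
    sigma1 G =
      sigma1 (G.induce ({v} : Set V)ᶜ) +
      sigma1 (G.induce (closedNbhd G v)ᶜ) +
      ∑ u ∈ (G.neighborSet v).toFinset,
        sigma0 (G.induce (closedNbhd G u ∪ closedNbhd G v)ᶜ) := by
  let A := {S : Set V | S ⊆ ({v} : Set V)ᶜ ∧ (edgesWithin G S).ncard = 1}
  let B := {S : Set V | (edgesWithin G S).ncard = 1 ∧ v ∈ S ∧ ∀ u ∈ S, ¬ G.Adj v u}
  let C := fun u => {S : Set V | (edgesWithin G S).ncard = 1 ∧ v ∈ S ∧ u ∈ S}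
  have hsplit : {S : Set V | (edgesWithin G S).ncard = 1} =
      A ∪ B ∪ ⋃ u ∈ (G.neighborSet v).toFinset, C u := by
    ext S
    simp only [A, B, C, Set.mem_union, Set.mem_ofPred_eq, Set.mem_iUnion, Set.mem_toFinset,
      SimpleGraph.mem_neighborSet, Set.subset_compl_singleton_iff, exists_prop]
    grind
  have hAB : Disjoint A B := by
    rw [Set.disjoint_left]
    rintro S ⟨hS, -⟩ ⟨-, hv, -⟩
    exact hS hv rfl
  have hABC : Disjoint (A ∪ B) (⋃ u ∈ (G.neighborSet v).toFinset, C u) := by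
    rw [Set.disjoint_left]
    intro S hS hC
    simp only [Set.mem_iUnion, Set.mem_toFinset, SimpleGraph.mem_neighborSet] at hC
    obtain ⟨u, hu, -, hvS, huS⟩ := hC
    rcases hS with ⟨hS, -⟩ | ⟨-, -, hn⟩
    · exact hS hvS rfl
    · exact hn u huS hu
  have hC : (⋃ u ∈ (G.neighborSet v).toFinset, C u).ncard =
      ∑ u ∈ (G.neighborSet v).toFinset, (C u).ncard := by
    have hdisj : ((G.neighborSet v).toFinset : Set V).PairwiseDisjoint
        fun u => (C u).toFinset := by
      intro a ha b hb hab
      rw [Function.onFun, Set.disjoint_toFinset, Set.disjoint_left]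
      rintro S ⟨h1, hv, haS⟩ ⟨-, -, hbS⟩
      obtain ⟨e, he⟩ := Set.ncard_eq_one.1 h1
      have h2 : s(v, a) ∈ edgesWithin G S := mk_mem_edgesWithin.2 ⟨by simpa using ha, hv, haS⟩
      have h3 : s(v, b) ∈ edgesWithin G S := mk_mem_edgesWithin.2 ⟨by simpa using hb, hv, hbS⟩
      rw [he] at h2 h3
      exact hab (Sym2.congr_right.1 (h2.trans h3.symm))
    simp only [Set.ncard_eq_toFinset_card']
    rw [← Finset.card_biUnion hdisj]
    congr 1
    ext S
    simp
  rw [sigma1, Nat.card_coe_set_eq, hsplit, Set.ncard_union_eq hABC, Set.ncard_union_eq hAB, hC,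
    ncard_setOf_mem_forall_not_adj, sigma1_induce G {v}ᶜ]
  congr 1
  exact Finset.sum_congr rfl fun u hu =>
    ncard_setOf_mem_mem_of_adj (Set.mem_toFinset.1 hu)
end

section
/- For the path Pₙ on n ≥ 1 vertices, σ₁(Pₙ) = (1/5)·[(n−1)(αⁿ + βⁿ) + (2/√5)(α^{n−1} − β^{n−1})], where α = (1+√5)/2 and β = (1−√5)/2. -/
/-- The number of pairs of consecutive `true` entries of a Boolean vector. -/
def truePairs {n : ℕ} (f : Fin (n + 1) → Bool) : ℕ :=
  ∑ i : Fin n, if f i.castSucc && f i.succ then 1 else 0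

/-- The number of Boolean vectors of length `n + 1` with first entry `b` and exactly `k` pairs of
consecutive `true` entries. -/
def truePairsCount (n : ℕ) (b : Bool) (k : ℕ) : ℕ :=
  ∑ f : Fin n → Bool, if truePairs (Fin.cons b f : Fin (n + 1) → Bool) = k then 1 else 0

lemma truePairs_cons {n : ℕ} (b : Bool) (f : Fin (n + 1) → Bool) :
    truePairs (Fin.cons b f : Fin (n + 2) → Bool) =
      (if b && f 0 then 1 else 0) + truePairs f := by
  unfold truePairs
  rw [Fin.sum_univ_succ]
  simp

lemma sum_boolVector_succ {n : ℕ} (g : (Fin (n + 1) → Bool) → ℕ) :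
    ∑ f, g f = (∑ f : Fin n → Bool, g (Fin.cons true f)) +
      ∑ f : Fin n → Bool, g (Fin.cons false f) := by
  rw [← (Fin.consEquiv fun _ : Fin (n + 1) => Bool).sum_comp, Fintype.sum_prod_type,
    Fintype.sum_bool]
  rfl

lemma truePairsCount_zero_left (b : Bool) (k : ℕ) :
    truePairsCount 0 b k = if k = 0 then 1 else 0 := by
  cases k <;> simp [truePairsCount, truePairs]

lemma truePairsCount_succ_false (n k : ℕ) :
    truePairsCount (n + 1) false k = truePairsCount n true k + truePairsCount n false k := by
  rw [truePairsCount]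
  simp only [truePairs_cons false, Bool.false_and, Bool.false_eq_true, if_false, zero_add]
  rw [sum_boolVector_succ]
  rfl

lemma truePairsCount_succ_true_zero (n : ℕ) :
    truePairsCount (n + 1) true 0 = truePairsCount n false 0 := by
  rw [truePairsCount, sum_boolVector_succ]
  simp [truePairsCount, truePairs_cons true]

lemma truePairsCount_succ_true_succ (n k : ℕ) :
    truePairsCount (n + 1) true (k + 1) =
      truePairsCount n true k + truePairsCount n false (k + 1) := by
  rw [truePairsCount, sum_boolVector_succ]
  simp [truePairsCount, truePairs_cons true, add_comm 1]

lemma truePairsCount_zero (n : ℕ) :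
    truePairsCount n true 0 = Nat.fib (n + 1) ∧ truePairsCount n false 0 = Nat.fib (n + 2) := by
  induction n with
  | zero => simp [truePairsCount_zero_left]
  | succ n ih =>
    rw [truePairsCount_succ_true_zero, truePairsCount_succ_false, ih.1, ih.2]
    exact ⟨rfl, Nat.fib_add_two.symm⟩

lemma truePairsCount_one (m : ℕ) :
    5 * truePairsCount (m + 1) false 1 =
        m * (2 * Nat.fib m + Nat.fib (m + 1)) + 2 * Nat.fib m ∧
      5 * truePairsCount (m + 1) true 1 + (m + 1) * Nat.fib m =
        (2 * m + 5) * Nat.fib (m + 1) := by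
  induction m with
  | zero =>
    rw [truePairsCount_succ_false, truePairsCount_succ_true_succ]
    simp [truePairsCount_zero_left]
  | succ m ih =>
    obtain ⟨h₁, h₂⟩ := ih
    rw [truePairsCount_succ_false, truePairsCount_succ_true_succ (m + 1) 0,
      (truePairsCount_zero (m + 1)).1, Nat.fib_add_two (n := m)]
    constructor <;> nlinarith

lemma edgesWithin_pathGraph_succ {m : ℕ} (S : Set (Fin (m + 1))) :
    edgesWithin (SimpleGraph.pathGraph (m + 1)) S =
      (fun i : Fin m => s(i.castSucc, i.succ)) '' {i | i.castSucc ∈ S ∧ i.succ ∈ S} := by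
  ext e
  induction e with | _ x y
  simp only [edgesWithin, Set.mem_ofPred_eq, SimpleGraph.mem_edgeSet, Sym2.mem_iff,
    forall_eq_or_imp, forall_eq, SimpleGraph.pathGraph_adj, Set.mem_image]
  constructor
  · rintro ⟨h | h, hx, hy⟩
    · have hx' : (⟨x, by omega⟩ : Fin m).castSucc = x := rfl
      have hy' : (⟨x, by omega⟩ : Fin m).succ = y := Fin.ext h
      exact ⟨⟨x, by omega⟩, ⟨hx' ▸ hx, hy' ▸ hy⟩, by rw [hx', hy']⟩
    · have hy' : (⟨y, by omega⟩ : Fin m).castSucc = y := rfl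
      have hx' : (⟨y, by omega⟩ : Fin m).succ = x := Fin.ext h
      exact ⟨⟨y, by omega⟩, ⟨hy' ▸ hy, hx' ▸ hx⟩, by rw [hx', hy', Sym2.eq_swap]⟩
  · rintro ⟨i, ⟨h₁, h₂⟩, h⟩
    rcases Sym2.eq_iff.1 h with ⟨rfl, rfl⟩ | ⟨rfl, rfl⟩
    · exact ⟨Or.inl (by simp), h₁, h₂⟩
    · exact ⟨Or.inr (by simp), h₂, h₁⟩

lemma ncard_edgesWithin_pathGraph_succ {m : ℕ} (f : Fin (m + 1) → Bool) :
    (edgesWithin (SimpleGraph.pathGraph (m + 1)) {i | f i = true}).ncard = truePairs f := by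
  rw [edgesWithin_pathGraph_succ, Set.ncard_image_of_injective, Set.ncard_eq_toFinset_card']
  · simp [truePairs]
  · intro i j h
    rcases Sym2.eq_iff.1 h with ⟨h, -⟩ | ⟨h₁, h₂⟩
    · exact Fin.castSucc_injective _ h
    · simp only [Fin.ext_iff, Fin.val_castSucc, Fin.val_succ] at h₁ h₂
      omega

lemma sigma1_pathGraph_succ (m : ℕ) :
    sigma1 (SimpleGraph.pathGraph (m + 1)) = truePairsCount (m + 1) false 1 := by
  classical
  let e : {f : Fin (m + 1) → Bool // truePairs f = 1} ≃
      {S : Set (Fin (m + 1)) | (edgesWithin (SimpleGraph.pathGraph (m + 1)) S).ncard = 1} :=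
    { toFun := fun f => ⟨{i | f.1 i = true}, by
        rw [Set.mem_ofPred_eq, ncard_edgesWithin_pathGraph_succ, f.2]⟩
      invFun := fun S => ⟨fun i => decide (i ∈ S.1), by
        rw [← ncard_edgesWithin_pathGraph_succ]
        simpa using S.2⟩
      left_inv := fun f => by simp
      right_inv := fun S => by simp }
  rw [sigma1, ← Nat.card_congr e, Nat.card_eq_fintype_card, Fintype.card_subtype,
    Finset.card_filter]
  simp [truePairsCount, truePairs_cons]

lemma goldenRatio_pow_add_goldenConj_pow (m : ℕ) :
    Real.goldenRatio ^ (m + 1) + Real.goldenConj ^ (m + 1) =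
      2 * (Nat.fib m : ℝ) + Nat.fib (m + 1) := by
  have h5 : Real.sqrt 5 ^ 2 = 5 := Real.sq_sqrt (by norm_num)
  rw [Real.coe_fib_eq, Real.coe_fib_eq, pow_succ, pow_succ]
  field_simp
  linear_combination (Real.goldenRatio ^ m - Real.goldenConj ^ m) * h5

/-- For the path `Pₙ` on `n ≥ 1` vertices,
`σ₁(Pₙ) = (1/5)·[(n−1)(αⁿ + βⁿ) + (2/√5)(α^{n−1} − β^{n−1})]`,
where `α = (1+√5)/2` and `β = (1−√5)/2`. -/
theorem sigma1_pathGraph (n : ℕ) (hn : 1 ≤ n) :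
    (sigma1 (SimpleGraph.pathGraph n) : ℝ) =
      (1 / 5) * (((n : ℝ) - 1) * (((1 + Real.sqrt 5) / 2) ^ n + ((1 - Real.sqrt 5) / 2) ^ n) +
        (2 / Real.sqrt 5) *
          (((1 + Real.sqrt 5) / 2) ^ (n - 1) - ((1 - Real.sqrt 5) / 2) ^ (n - 1))) := by
  obtain ⟨m, rfl⟩ := Nat.exists_eq_add_of_le' hn
  have hcount : (5 : ℝ) * truePairsCount (m + 1) false 1 =
      m * (2 * Nat.fib m + Nat.fib (m + 1)) + 2 * Nat.fib m := by
    exact_mod_cast (truePairsCount_one m).1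
  rw [sigma1_pathGraph_succ, Nat.add_sub_cancel]
  change _ = (1 / 5) * (((m + 1 : ℕ) - 1 : ℝ) *
    (Real.goldenRatio ^ (m + 1) + Real.goldenConj ^ (m + 1)) +
      2 / Real.sqrt 5 * (Real.goldenRatio ^ m - Real.goldenConj ^ m))
  rw [goldenRatio_pow_add_goldenConj_pow, div_mul_eq_mul_div 2, mul_div_assoc 2, ← Real.coe_fib_eq]
  push_cast
  linarith
end

section
/- Let n ≥ 3 and let Uₙ be the unicyclic graph of order n obtained from the star K_{1,n−1} by adding one edge between two leaves. Then σ₁(Uₙ) = n − 1 + 2^{n−3}. -/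
/-- The unicyclic graph `Uₙ` of order `n` obtained from the star `K_{1,n−1}`
(with centre `0` and leaves `1, …, n−1`) by adding one edge between the two
leaves `1` and `2`. -/
def unicyclicU (n : ℕ) : SimpleGraph (Fin n) :=
  SimpleGraph.fromRel (fun a b => a.val = 0 ∨ (a.val = 1 ∧ b.val = 2))

theorem edgesWithin_ncard_eq_one_iff {V : Type*} (G : SimpleGraph V) (S : Set V) :
    (edgesWithin G S).ncard = 1 ↔ ∃ a b, G.Adj a b ∧ a ∈ S ∧ b ∈ S ∧
      ∀ c d, G.Adj c d → c ∈ S → d ∈ S → s(c, d) = s(a, b) := by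
  rw [Set.ncard_eq_one, Sym2.exists]
  refine exists₂_congr fun a b => ?_
  simp only [Set.eq_singleton_iff_unique_mem, edgesWithin, Set.mem_ofPred_eq, Sym2.forall,
    SimpleGraph.mem_edgeSet, Sym2.ball, and_imp, and_assoc]

theorem unicyclicU_adj (m : ℕ) (a b : Fin (m + 3)) :
    (unicyclicU (m + 3)).Adj a b ↔
      a ≠ b ∧ (a = 0 ∨ b = 0 ∨ (a = 1 ∧ b = 2) ∨ (a = 2 ∧ b = 1)) := by
  have h2 : ((2 : Fin (m + 3)) : ℕ) = 2 := rfl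
  simp only [unicyclicU, SimpleGraph.fromRel_adj, Fin.ext_iff, Fin.val_zero, Fin.val_one, h2]
  tauto

theorem edgesWithin_unicyclicU_ncard_eq_one_iff (m : ℕ) (S : Finset (Fin (m + 3))) :
    (edgesWithin (unicyclicU (m + 3)) (S : Set (Fin (m + 3)))).ncard = 1 ↔
      (∃ v, v ≠ 0 ∧ {0, v} = S) ∨ ({1, 2} ⊆ S ∧ S ⊆ {0}ᶜ) := by
  have h01 : (0 : Fin (m + 3)) ≠ 1 := by simp
  have h02 : (0 : Fin (m + 3)) ≠ 2 := Fin.ne_of_val_ne (by decide : (0 : ℕ) ≠ 2)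
  have h12 : (1 : Fin (m + 3)) ≠ 2 := Fin.ne_of_val_ne (by decide : (1 : ℕ) ≠ 2)
  have hz : S ⊆ {0}ᶜ ↔ (0 : Fin (m + 3)) ∉ S := by
    rw [Finset.subset_compl_comm, Finset.singleton_subset_iff, Finset.mem_compl]
  simp only [edgesWithin_ncard_eq_one_iff, unicyclicU_adj, Finset.mem_coe, hz,
    Finset.insert_subset_iff, Finset.singleton_subset_iff, Sym2.eq_iff]
  constructor
  · rintro ⟨a, b, ⟨hab, h⟩, ha, hb, huniq⟩
    by_cases h0 : (0 : Fin (m + 3)) ∈ S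
    · left
      have key : ∀ v ∈ S, v ≠ 0 → (0 = a ∧ v = b) ∨ (0 = b ∧ v = a) :=
        fun v hv hv0 => huniq 0 v ⟨hv0.symm, Or.inl rfl⟩ h0 hv
      obtain ⟨w, hw, hw0⟩ : ∃ w ∈ S, w ≠ 0 := by
        by_cases ha0 : a = 0
        · exact ⟨b, hb, fun hb0 => hab (ha0.trans hb0.symm)⟩
        · exact ⟨a, ha, ha0⟩
      refine ⟨w, hw0, ?_⟩
      ext x
      simp only [Finset.mem_insert, Finset.mem_singleton]
      grind
    · right
      grind
  · rintro (⟨v, hv, rfl⟩ | ⟨⟨h1, h2⟩, h0⟩)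
    · refine ⟨0, v, ⟨hv.symm, Or.inl rfl⟩, by simp, by simp, ?_⟩
      simp only [Finset.mem_insert, Finset.mem_singleton]
      grind
    · exact ⟨1, 2, ⟨h12, by simp⟩, h1, h2, by grind⟩

theorem sigma1_eq_card_filter {V : Type*} [Fintype V] (G : SimpleGraph V)
    [DecidablePred fun S : Finset V => (edgesWithin G (S : Set V)).ncard = 1] :
    sigma1 G = (Finset.univ.filter
      fun S : Finset V => (edgesWithin G (S : Set V)).ncard = 1).card := by
  rw [← Fintype.card_subtype, ← Nat.card_eq_fintype_card]
  exact (Nat.card_congr (Fintype.finsetEquivSet.subtypeEquiv fun _ => Iff.rfl)).symm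

/-- For `n ≥ 3`, the unicyclic graph `Uₙ` obtained from the star `K_{1,n−1}` by adding one
edge between two leaves satisfies `σ₁(Uₙ) = n − 1 + 2^{n−3}`. -/
theorem sigma1_unicyclicU (n : ℕ) (hn : 3 ≤ n) :
    sigma1 (unicyclicU n) = n - 1 + 2 ^ (n - 3) := by
  classical
  obtain ⟨m, rfl⟩ := Nat.exists_eq_add_of_le' hn
  have hset : (Finset.univ.filter fun S : Finset (Fin (m + 3)) =>
      (edgesWithin (unicyclicU (m + 3)) (S : Set (Fin (m + 3)))).ncard = 1) =
      (Finset.univ.erase 0).image (fun v => {0, v}) ∪ Finset.Icc {1, 2} {0}ᶜ := by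
    ext S
    simp only [edgesWithin_unicyclicU_ncard_eq_one_iff, Finset.mem_filter, Finset.mem_univ,
      true_and, Finset.mem_union, Finset.mem_image, Finset.mem_erase, and_true, Finset.mem_Icc]
  have hdisj : Disjoint ((Finset.univ.erase 0).image fun v : Fin (m + 3) => ({0, v} : Finset _))
      (Finset.Icc {1, 2} {0}ᶜ) := by
    rw [Finset.disjoint_left]
    intro S hS hS'
    obtain ⟨v, -, rfl⟩ := Finset.mem_image.mp hS
    simpa using (Finset.mem_Icc.mp hS').2 (Finset.mem_insert_self 0 {v})
  have hinj : Set.InjOn (fun v : Fin (m + 3) => ({0, v} : Finset _))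
      (Finset.univ.erase 0 : Finset (Fin (m + 3))) := by
    intro v hv w _ hvw
    have hmem : v ∈ ({0, w} : Finset (Fin (m + 3))) := by
      rw [← show ({0, v} : Finset (Fin (m + 3))) = {0, w} from hvw]
      simp
    simp_all
  have h12 : (1 : Fin (m + 3)) ≠ 2 := Fin.ne_of_val_ne (by decide : (1 : ℕ) ≠ 2)
  have hsub : ({1, 2} : Finset (Fin (m + 3))) ⊆ {0}ᶜ := by
    intro x hx
    rcases Finset.mem_insert.mp hx with rfl | hx
    · simp
    · rw [Finset.mem_singleton.mp hx, Finset.mem_compl, Finset.mem_singleton]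
      exact Fin.ne_of_val_ne (by decide : (2 : ℕ) ≠ 0)
  rw [sigma1_eq_card_filter, hset, Finset.card_union_of_disjoint hdisj,
    Finset.card_image_of_injOn hinj, Finset.card_Icc_finset hsub, Finset.card_pair h12,
    Finset.card_compl, Finset.card_erase_of_mem (Finset.mem_univ _)]
  simp
end

section
/- For the cycle Cₙ on n ≥ 3 vertices, σ₁(Cₙ) = (n/√5)·(α^{n−2} − β^{n−2}), where α = (1+√5)/2 and β = (1−√5)/2. -/
/-- The subsets of `{0, …, k}` that contain `0` and no two consecutive numbers. -/
def zeroSparse : ℕ → Finset (Finset ℕ)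
  | 0 => {{0}}
  | 1 => {{0}}
  | k + 2 => zeroSparse (k + 1) ∪ (zeroSparse k).image (insert (k + 2))

theorem mem_zeroSparse (k : ℕ) (T : Finset ℕ) :
    T ∈ zeroSparse k ↔ 0 ∈ T ∧ (∀ j ∈ T, j ≤ k) ∧ ∀ j ∈ T, j + 1 ∉ T := by
  induction k using Nat.twoStepInduction generalizing T with
  | zero =>
    simp only [zeroSparse, Finset.mem_singleton]
    constructor
    · rintro rfl
      simp
    · rintro ⟨h0, h1, -⟩
      ext x
      grind
  | one =>
    simp only [zeroSparse, Finset.mem_singleton]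
    constructor
    · rintro rfl
      simp
    · rintro ⟨h0, h1, h2⟩
      have h3 := h2 0 h0
      ext x
      rw [Finset.mem_singleton]
      constructor
      · intro hx
        have := h1 x hx
        by_contra h
        obtain rfl : x = 0 + 1 := by omega
        exact h3 hx
      · rintro rfl
        exact h0
  | more k ih1 ih2 =>
    simp only [zeroSparse, Finset.mem_union, Finset.mem_image, ih1, ih2]
    constructor
    · rintro (⟨h0, h1, h2⟩ | ⟨T, ⟨h0, h1, h2⟩, rfl⟩)
      · exact ⟨h0, fun j hj => (h1 j hj).trans (by omega), h2⟩
      · refine ⟨by simp [h0], by grind, ?_⟩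
        intro j hj hj'
        rw [Finset.mem_insert] at hj hj'
        rcases hj with rfl | hj
        · rcases hj' with hj' | hj'
          · omega
          · have := h1 _ hj'
            omega
        · have := h1 _ hj
          rcases hj' with hj' | hj'
          · omega
          · exact h2 j hj hj'
    · rintro ⟨h0, h1, h2⟩
      by_cases hk : k + 2 ∈ T
      · refine Or.inr ⟨T.erase (k + 2), ⟨by simp [h0], ?_, ?_⟩, Finset.insert_erase hk⟩
        · intro j hj
          rw [Finset.mem_erase] at hj
          have h3 := h1 j hj.2
          by_contra h
          obtain rfl : j = k + 1 := by omega
          exact h2 _ hj.2 hk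
        · intro j hj hj'
          exact h2 j (Finset.mem_of_mem_erase hj) (Finset.mem_of_mem_erase hj')
      · refine Or.inl ⟨h0, fun j hj => ?_, h2⟩
        have h3 := h1 j hj
        have : j ≠ k + 2 := fun h => hk (h ▸ hj)
        omega

theorem card_zeroSparse (k : ℕ) : (zeroSparse k).card = Nat.fib (k + 1) := by
  induction k using Nat.twoStepInduction with
  | zero => simp [zeroSparse]
  | one => simp [zeroSparse]
  | more k ih1 ih2 =>
    have hk : ∀ l ≤ k + 1, ∀ T ∈ zeroSparse l, k + 2 ∉ T := by
      intro l hl T hT h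
      have := ((mem_zeroSparse l T).1 hT).2.1 _ h
      omega
    rw [zeroSparse, Finset.card_union_of_disjoint, Finset.card_image_of_injOn, ih1, ih2,
      Nat.fib_add_two (n := k + 1), add_comm]
    · intro T hT U hU h
      rw [← Finset.erase_insert (hk k (by omega) T hT), h,
        Finset.erase_insert (hk k (by omega) U hU)]
    · rw [Finset.disjoint_left]
      intro T hT hT'
      obtain ⟨U, -, rfl⟩ := Finset.mem_image.1 hT'
      exact hk _ le_rfl _ hT (Finset.mem_insert_self _ _)

/-- The vertices of `S` whose cyclic successor is also in `S`. -/
def succPairs {n : ℕ} [NeZero n] (S : Set (Fin n)) : Set (Fin n) :=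
  {i | i ∈ S ∧ i + 1 ∈ S}

theorem edgesWithin_cycleGraph (m : ℕ) (S : Set (Fin (m + 3))) :
    edgesWithin (SimpleGraph.cycleGraph (m + 3)) S =
      (fun i => s(i, i + 1)) '' succPairs S := by
  ext e
  induction e using Sym2.ind with
  | _ x y =>
    simp only [edgesWithin, succPairs, Set.mem_ofPred_eq, SimpleGraph.mem_edgeSet,
      SimpleGraph.cycleGraph_adj, Sym2.mem_iff, Set.mem_image, Sym2.eq_iff,
      forall_eq_or_imp, forall_eq]
    constructor
    · rintro ⟨h | h, hx, hy⟩
      · obtain rfl : x = y + 1 := by rw [← h]; abel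
        exact ⟨y, ⟨hy, hx⟩, Or.inr ⟨rfl, rfl⟩⟩
      · obtain rfl : y = x + 1 := by rw [← h]; abel
        exact ⟨x, ⟨hx, hy⟩, Or.inl ⟨rfl, rfl⟩⟩
    · rintro ⟨i, ⟨h1, h2⟩, ⟨rfl, rfl⟩ | ⟨rfl, rfl⟩⟩
      · exact ⟨Or.inr (by abel), h1, h2⟩
      · exact ⟨Or.inl (by abel), h2, h1⟩

theorem injective_succ_edge (m : ℕ) :
    Function.Injective (fun i : Fin (m + 3) => s(i, i + 1)) := by
  intro i j h
  rcases Sym2.eq_iff.1 h with ⟨h, -⟩ | ⟨h1, h2⟩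
  · exact h
  · rw [h1, add_assoc, add_eq_left] at h2
    have := congrArg Fin.val h2
    simp [Fin.val_add, Nat.mod_eq_of_lt] at this

theorem sigma1_cycleGraph_eq_card (m : ℕ) :
    sigma1 (SimpleGraph.cycleGraph (m + 3)) =
      (m + 3) * Nat.card {S : Set (Fin (m + 3)) | succPairs S = {Fin.last (m + 2)}} := by
  have hS : {S : Set (Fin (m + 3)) |
      (edgesWithin (SimpleGraph.cycleGraph (m + 3)) S).ncard = 1} =
      {S | ∃ a, succPairs S = {a}} := by
    ext S
    rw [Set.mem_ofPred_eq, edgesWithin_cycleGraph,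
      Set.ncard_image_of_injective _ (injective_succ_edge m), Set.ncard_eq_one]
    rfl
  have hshift : ∀ (a b : Fin (m + 3)) (S : Set (Fin (m + 3))), succPairs S = {b} →
      succPairs {x | x - a ∈ S} = {b + a} := by
    intro a b S h
    ext x
    have := Set.ext_iff.1 h (x - a)
    simp only [succPairs, Set.mem_ofPred_eq, Set.mem_singleton_iff] at this ⊢
    rw [add_sub_right_comm, this, sub_eq_iff_eq_add]
  rw [sigma1, hS]
  refine Eq.trans (Eq.symm ?_) ((Nat.card_prod (Fin (m + 3)) _).trans
    (congrArg (· * _) (Nat.card_fin _)))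
  refine Nat.card_congr (Equiv.ofBijective
    (fun p => ⟨{x | x - p.1 ∈ p.2.1}, _, hshift p.1 _ _ p.2.2⟩) ⟨?_, ?_⟩)
  · rintro ⟨a, S, hS⟩ ⟨b, T, hT⟩ h
    have h' : {x | x - a ∈ S} = {x | x - b ∈ T} := congrArg Subtype.val h
    have h1 := hshift a _ S hS
    rw [h', hshift b _ T hT, Set.singleton_eq_singleton_iff, add_right_inj] at h1
    subst h1
    obtain rfl : S = T := by
      ext x
      simpa using Set.ext_iff.1 h' (x + b)
    rfl
  · rintro ⟨S, a, hS⟩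
    refine ⟨⟨a - Fin.last _, {x | x - (Fin.last _ - a) ∈ S}, ?_⟩, ?_⟩
    · have := hshift (Fin.last _ - a) a S hS
      rwa [add_sub_cancel] at this
    · apply Subtype.ext
      ext x
      change x - (a - Fin.last (m + 2)) - (Fin.last (m + 2) - a) ∈ S ↔ x ∈ S
      rw [sub_sub, sub_add_sub_cancel, sub_self, sub_zero]

theorem card_succPairs_eq_last (m : ℕ) :
    Nat.card {S : Set (Fin (m + 3)) | succPairs S = {Fin.last (m + 2)}} = Nat.fib (m + 1) := by
  rw [← card_zeroSparse, ← Nat.card_eq_finsetCard]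
  have hlast : ∀ T ∈ zeroSparse m, succPairs {x : Fin (m + 3) | x.val ∈ T ∨ x.val = m + 2} =
      {Fin.last (m + 2)} := by
    intro T hT
    obtain ⟨h0, h1, h2⟩ := (mem_zeroSparse m T).1 hT
    ext x
    simp only [succPairs, Set.mem_ofPred_eq, Set.mem_singleton_iff, Fin.val_add_one]
    split_ifs with hx
    · simp [hx, h0]
    · have hx' : x.val ≠ m + 2 := fun h => hx (Fin.ext h)
      simp only [hx, hx', or_false, iff_false, not_and, not_or]
      intro h
      have := h1 _ h
      exact ⟨h2 _ h, by omega⟩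
  symm
  refine Nat.card_congr (Equiv.ofBijective (fun T => ⟨_, hlast T.1 T.2⟩) ⟨?_, ?_⟩)
  · rintro ⟨T, hT⟩ ⟨U, hU⟩ h
    have h' : {x : Fin (m + 3) | x.val ∈ T ∨ x.val = m + 2} =
      {x | x.val ∈ U ∨ x.val = m + 2} := congrArg Subtype.val h
    have hT1 := ((mem_zeroSparse m T).1 hT).2.1
    have hU1 := ((mem_zeroSparse m U).1 hU).2.1
    apply Subtype.ext
    ext x
    by_cases hx : x ≤ m
    · have := Set.ext_iff.1 h' ⟨x, by omega⟩
      simpa [show x ≠ m + 2 by omega] using this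
    · exact ⟨fun h => absurd (hT1 x h) hx, fun h => absurd (hU1 x h) hx⟩
  · rintro ⟨S, hS⟩
    have hS' : ∀ x : Fin (m + 3), (x ∈ S ∧ x + 1 ∈ S) ↔ x = Fin.last (m + 2) :=
      Set.ext_iff.1 hS
    obtain ⟨hl, h0⟩ := (hS' (Fin.last _)).2 rfl
    rw [Fin.last_add_one] at h0
    have hsucc : ∀ (j : ℕ) (hj : j + 1 < m + 3),
        (⟨j, by omega⟩ : Fin (m + 3)) ∈ S → (⟨j + 1, hj⟩ : Fin (m + 3)) ∉ S := by
      intro j hj h1 h2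
      have hne : (⟨j, by omega⟩ : Fin (m + 3)) ≠ Fin.last (m + 2) := by
        rw [Ne, Fin.ext_iff, Fin.val_last]
        change j ≠ m + 2
        omega
      refine hne ((hS' _).1 ⟨h1, ?_⟩)
      convert h2
      rw [Fin.val_add_one, if_neg hne]
    classical
    have hmem : ∀ j, j ∈ (Finset.range (m + 1)).filter
        (fun j => ∃ h : j < m + 3, (⟨j, h⟩ : Fin (m + 3)) ∈ S) ↔
        j ≤ m ∧ ∃ h : j < m + 3, (⟨j, h⟩ : Fin (m + 3)) ∈ S := by
      simp [Nat.lt_succ_iff]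
    refine ⟨⟨(Finset.range (m + 1)).filter
      (fun j => ∃ h : j < m + 3, (⟨j, h⟩ : Fin (m + 3)) ∈ S), ?_⟩, ?_⟩
    · rw [mem_zeroSparse]
      simp only [hmem]
      refine ⟨⟨by omega, by omega, h0⟩, fun j hj => hj.1, ?_⟩
      rintro j ⟨_, _, h1⟩ ⟨_, h, h2⟩
      exact hsucc j h h1 h2
    · apply Subtype.ext
      ext ⟨x, hx⟩
      simp only [hmem, Set.mem_ofPred_eq]
      constructor
      · rintro (⟨_, _, h⟩ | rfl)
        · exact h
        · exact hl
      · intro h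
        by_cases hxm : x = m + 2
        · exact Or.inr hxm
        · refine Or.inl ⟨?_, hx, h⟩
          by_contra hlt
          obtain rfl : x = m + 1 := by omega
          exact hsucc (m + 1) (by omega) h hl

/-- For the cycle `Cₙ` on `n ≥ 3` vertices, `σ₁(Cₙ) = (n/√5)·(α^{n−2} − β^{n−2})`,
where `α = (1+√5)/2` and `β = (1−√5)/2`. -/
theorem sigma1_cycleGraph (n : ℕ) (hn : 3 ≤ n) :
    (sigma1 (SimpleGraph.cycleGraph n) : ℝ) =
      ((n : ℝ) / Real.sqrt 5) *
        (((1 + Real.sqrt 5) / 2) ^ (n - 2) - ((1 - Real.sqrt 5) / 2) ^ (n - 2)) := by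
  obtain ⟨m, rfl⟩ := Nat.exists_eq_add_of_le' hn
  rw [sigma1_cycleGraph_eq_card, card_succPairs_eq_last, Nat.cast_mul, Real.coe_fib_eq,
    Real.goldenRatio, Real.goldenConj, show m + 3 - 2 = m + 1 by omega]
  ring
end

section
/- Let k ≥ 2 and n ≥ k, and let Bₙᵏ be the broom graph: the tree of order n obtained from the path P_k by adding n − k new vertices each joined to the same fixed end-vertex of P_k. Then σ₁(Bₙᵏ) = σ₁(P_{k−1})·2^{n−k} + σ₁(P_{k−2}) + σ₀(P_{k−3}) + (n−k)·σ₀(P_{k−2}), with the conventions σ₁(P_t) = 0 for t ≤ 0 and σ₀(P_t) = 1 for t ≤ 0. -/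
/-- The broom graph `Bₙᵏ`: the tree of order `n` obtained from the path `P_k`
(on vertices `0, …, k−1`) by adding `n − k` new vertices (`k, …, n−1`), each joined to the
end-vertex `k−1` of the path. -/
def broomGraph (n k : ℕ) : SimpleGraph (Fin n) :=
  SimpleGraph.fromRel
    (fun a b => (a.val + 1 = b.val ∧ b.val < k) ∨ (a.val = k - 1 ∧ k ≤ b.val))

/-- The number of edges of the broom with handle `P_k` inside a set `S` of natural numbers:
each `b ≥ 1` is joined to the single smaller vertex `min b k - 1`. -/
def broomEdgeCount (k : ℕ) (S : Finset ℕ) : ℕ :=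
  (S.filter fun b => ∃ a ∈ S, a + 1 = min b k).card

/-- The number of subsets of `{0, …, n - 1}` containing exactly `j` edges of the broom with
handle `P_k`. -/
def broomSubsetCount (k n j : ℕ) : ℕ :=
  ((Finset.range n).powerset.filter fun S => broomEdgeCount k S = j).card

theorem broomGraph_adj_iff {n k : ℕ} (hk : 1 ≤ k) (a b : Fin n) :
    (broomGraph n k).Adj a b ↔ a.val + 1 = min b.val k ∨ b.val + 1 = min a.val k := by
  simp only [broomGraph, SimpleGraph.fromRel_adj, ne_eq, Fin.ext_iff]
  omega

theorem pathGraph_eq_broomGraph {n k : ℕ} (hk : 1 ≤ k) (hn : n ≤ k) :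
    SimpleGraph.pathGraph n = broomGraph n k := by
  ext a b
  rw [broomGraph_adj_iff hk, SimpleGraph.pathGraph_adj]
  omega

/-- A set of vertices of a graph on `Fin n`, as a finite set of natural numbers. -/
noncomputable def finSetVals {n : ℕ} (S : Set (Fin n)) : Finset ℕ :=
  S.toFinite.toFinset.map Fin.valEmbedding

theorem mem_finSetVals {n : ℕ} {S : Set (Fin n)} {x : ℕ} :
    x ∈ finSetVals S ↔ ∃ h : x < n, (⟨x, h⟩ : Fin n) ∈ S := by
  simp only [finSetVals, Finset.mem_map, Set.Finite.mem_toFinset, Fin.valEmbedding_apply]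
  constructor
  · rintro ⟨a, ha, rfl⟩
    exact ⟨a.2, ha⟩
  · rintro ⟨h, hx⟩
    exact ⟨_, hx, rfl⟩

theorem ncard_edgesWithin_broomGraph {n k : ℕ} (hk : 1 ≤ k) (S : Set (Fin n)) :
    (edgesWithin (broomGraph n k) S).ncard = broomEdgeCount k (finSetVals S) := by
  rw [broomEdgeCount, ← Set.ncard_coe_finset]
  symm
  refine Set.ncard_congr
    (fun b hb => s(⟨min b k - 1, ?_⟩, ⟨b, ?_⟩)) ?_ ?_ ?_
  · obtain ⟨h, -⟩ := mem_finSetVals.1 (Finset.mem_filter.1 hb).1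
    omega
  · exact (mem_finSetVals.1 (Finset.mem_filter.1 hb).1).1
  · intro b hb
    obtain ⟨hb, a, ha, hab⟩ := Finset.mem_filter.1 hb
    obtain ⟨hbn, hbS⟩ := mem_finSetVals.1 hb
    obtain ⟨han, haS⟩ := mem_finSetVals.1 ha
    obtain rfl : a = min b k - 1 := by omega
    refine ⟨?_, ?_⟩
    · rw [SimpleGraph.mem_edgeSet, broomGraph_adj_iff hk]
      exact Or.inl hab
    · simp [haS, hbS]
  · intro b c hb hc h
    obtain ⟨-, a, -, hab⟩ := Finset.mem_filter.1 hb
    obtain ⟨-, d, -, hdc⟩ := Finset.mem_filter.1 hc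
    simp only [Sym2.eq_iff, Fin.mk.injEq] at h
    omega
  · intro e
    induction e using Sym2.ind with
    | _ a b =>
      rintro ⟨hadj, hS⟩
      rw [SimpleGraph.mem_edgeSet, broomGraph_adj_iff hk] at hadj
      have ha := hS a (Sym2.mem_mk_left a b)
      have hb := hS b (Sym2.mem_mk_right a b)
      have ha' : a.val ∈ finSetVals S := mem_finSetVals.2 ⟨a.2, ha⟩
      have hb' : b.val ∈ finSetVals S := mem_finSetVals.2 ⟨b.2, hb⟩
      rcases hadj with h | h
      · refine ⟨b, Finset.mem_filter.2 ⟨hb', a, ha', h⟩, ?_⟩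
        exact Sym2.eq_iff.2 (Or.inl ⟨Fin.ext (by dsimp only; omega), rfl⟩)
      · refine ⟨a, Finset.mem_filter.2 ⟨ha', b, hb', h⟩, ?_⟩
        exact Sym2.eq_iff.2 (Or.inr ⟨Fin.ext (by dsimp only; omega), rfl⟩)

theorem card_setOf_broomEdgeCount (n k j : ℕ) :
    Nat.card {S : Set (Fin n) | broomEdgeCount k (finSetVals S) = j} =
      broomSubsetCount k n j := by
  rw [Nat.card_coe_set_eq, broomSubsetCount, ← Set.ncard_coe_finset]
  refine Set.ncard_congr (fun S _ => finSetVals S) ?_ ?_ ?_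
  · intro S hS
    refine Finset.mem_filter.2 ⟨Finset.mem_powerset.2 fun x hx => ?_, hS⟩
    exact Finset.mem_range.2 (mem_finSetVals.1 hx).1
  · intro S T _ _ h
    ext x
    have := congrArg (x.val ∈ ·) h
    simpa [mem_finSetVals] using this
  · intro T hT
    obtain ⟨hT, hj⟩ := Finset.mem_filter.1 hT
    have hval : finSetVals {x : Fin n | x.val ∈ T} = T := by
      ext x
      rw [mem_finSetVals]
      exact ⟨fun ⟨_, h⟩ => h, fun h => ⟨Finset.mem_range.1 (Finset.mem_powerset.1 hT h), h⟩⟩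
    exact ⟨{x | x.val ∈ T}, by simpa [hval] using hj, hval⟩

theorem sigma1_broomGraph_eq_broomSubsetCount {n k : ℕ} (hk : 1 ≤ k) :
    sigma1 (broomGraph n k) = broomSubsetCount k n 1 := by
  simp only [sigma1, ncard_edgesWithin_broomGraph hk, card_setOf_broomEdgeCount]

theorem sigma0_broomGraph_eq_broomSubsetCount {n k : ℕ} (hk : 1 ≤ k) :
    sigma0 (broomGraph n k) = broomSubsetCount k n 0 := by
  have h (S : Set (Fin n)) : edgesWithin (broomGraph n k) S = ∅ ↔
      broomEdgeCount k (finSetVals S) = 0 := by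
    rw [← ncard_edgesWithin_broomGraph hk, Set.ncard_eq_zero (Set.toFinite _)]
  simp only [sigma0, h, card_setOf_broomEdgeCount]

theorem card_filter_powerset_range_succ (n : ℕ) (P : Finset ℕ → Prop) [DecidablePred P] :
    ((Finset.range (n + 1)).powerset.filter P).card =
      ((Finset.range n).powerset.filter P).card +
        ((Finset.range n).powerset.filter fun S => P (insert n S)).card := by
  simp only [Finset.card_filter, Finset.range_add_one,
    Finset.sum_powerset_insert Finset.notMem_range_self]

theorem card_filter_powerset_range_congr {n : ℕ} {P Q : Finset ℕ → Prop}
    [DecidablePred P] [DecidablePred Q] (h : ∀ S ⊆ Finset.range n, (P S ↔ Q S)) :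
    ((Finset.range n).powerset.filter P).card = ((Finset.range n).powerset.filter Q).card :=
  congrArg Finset.card (Finset.filter_congr fun S hS => h S (Finset.mem_powerset.1 hS))

theorem broomEdgeCount_insert {k n : ℕ} {S : Finset ℕ} (hS : S ⊆ Finset.range n) :
    broomEdgeCount k (insert n S) =
      broomEdgeCount k S + if ∃ a ∈ S, a + 1 = min n k then 1 else 0 := by
  have hn : n ∉ S := fun h => Finset.notMem_range_self (hS h)
  have hfilter : (S.filter fun b => ∃ a ∈ insert n S, a + 1 = min b k) =
      S.filter fun b => ∃ a ∈ S, a + 1 = min b k := by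
    refine Finset.filter_congr fun b hb => ?_
    have := Finset.mem_range.1 (hS hb)
    rw [Finset.exists_mem_insert, or_iff_right (by omega)]
  have hself : (∃ a ∈ insert n S, a + 1 = min n k) ↔ ∃ a ∈ S, a + 1 = min n k := by
    rw [Finset.exists_mem_insert, or_iff_right (by omega)]
  simp only [broomEdgeCount, Finset.filter_insert, hfilter, hself]
  split_ifs
  · rw [Finset.card_insert_of_notMem fun h => hn (Finset.mem_filter.1 h).1]
  · rfl

/-- Adding the vertex `n`, whose smaller neighbour is `p`. -/
theorem broomEdgeCount_insert_of_eq {k n p : ℕ} {S : Finset ℕ} (hS : S ⊆ Finset.range n)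
    (hp : p + 1 = min n k) :
    broomEdgeCount k (insert n S) = broomEdgeCount k S + if p ∈ S then 1 else 0 := by
  have h : (∃ a ∈ S, a + 1 = min n k) ↔ p ∈ S :=
    ⟨fun ⟨a, ha, hap⟩ => by rwa [show p = a by omega], fun h => ⟨p, h, hp⟩⟩
  simp only [broomEdgeCount_insert hS, h]

/-- Subsets avoiding the vertex `h` of the broom to which the leaves are attached. -/
theorem card_notMem_center (h r j : ℕ) :
    ((Finset.range (h + 1 + r)).powerset.filter
      fun S => h ∉ S ∧ broomEdgeCount (h + 1) S = j).card =
      broomSubsetCount (h + 1) h j * 2 ^ r := by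
  induction r with
  | zero =>
    rw [add_zero, card_filter_powerset_range_succ, pow_zero, mul_one, broomSubsetCount]
    simp only [Finset.mem_insert_self, not_true_eq_false, false_and, Finset.filter_false,
      Finset.card_empty, add_zero]
    exact card_filter_powerset_range_congr fun S hS =>
      and_iff_right fun hh => Finset.notMem_range_self (hS hh)
  | succ r ih =>
    rw [← add_assoc, card_filter_powerset_range_succ, pow_succ, ← mul_assoc, mul_two, ← ih]
    congr 1
    refine card_filter_powerset_range_congr fun S hS => ?_
    rw [broomEdgeCount_insert_of_eq (p := h) hS (by omega), Finset.mem_insert,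
      or_iff_right (by omega)]
    by_cases hh : h ∈ S <;> simp [hh]

theorem card_mem_center_zero (h r : ℕ) :
    ((Finset.range (h + 1 + r)).powerset.filter
      fun S => h ∈ S ∧ broomEdgeCount (h + 1) S = 0).card =
      ((Finset.range (h + 1)).powerset.filter
        fun S => h ∈ S ∧ broomEdgeCount (h + 1) S = 0).card := by
  induction r with
  | zero => rfl
  | succ r ih =>
    rw [← add_assoc, card_filter_powerset_range_succ, ih, Nat.add_eq_left, Finset.card_eq_zero,
      Finset.filter_eq_empty_iff]
    intro S hS
    rw [broomEdgeCount_insert_of_eq (p := h) (Finset.mem_powerset.1 hS) (by omega),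
      Finset.mem_insert, or_iff_right (by omega)]
    by_cases hh : h ∈ S <;> simp [hh]

theorem card_mem_center_one (h r : ℕ) :
    ((Finset.range (h + 1 + r)).powerset.filter
      fun S => h ∈ S ∧ broomEdgeCount (h + 1) S = 1).card =
      ((Finset.range (h + 1)).powerset.filter
        fun S => h ∈ S ∧ broomEdgeCount (h + 1) S = 1).card +
      r * ((Finset.range (h + 1)).powerset.filter
        fun S => h ∈ S ∧ broomEdgeCount (h + 1) S = 0).card := by
  induction r with
  | zero => simp
  | succ r ih =>
    rw [← add_assoc, card_filter_powerset_range_succ, ih, add_one_mul, add_assoc,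
      ← card_mem_center_zero h r]
    congr 2
    refine card_filter_powerset_range_congr fun S hS => ?_
    rw [broomEdgeCount_insert_of_eq (p := h) hS (by omega), Finset.mem_insert,
      or_iff_right (by omega)]
    by_cases hh : h ∈ S <;> simp [hh]

/-- Subsets of `{0, …, m + 1}` with `j` edges containing the last vertex `m + 1`, split
according to whether they contain `m`. -/
theorem card_mem_last {k m : ℕ} (hm : m + 1 < k) (j : ℕ) :
    ((Finset.range (m + 2)).powerset.filter
      fun S => m + 1 ∈ S ∧ broomEdgeCount k S = j).card =
      broomSubsetCount k m j +
      ((Finset.range m).powerset.filter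
        fun S => broomEdgeCount k (insert m S) + 1 = j).card := by
  have hfirst : ((Finset.range (m + 1)).powerset.filter
      fun S => m + 1 ∈ S ∧ broomEdgeCount k S = j).card = 0 := by
    rw [Finset.card_eq_zero, Finset.filter_eq_empty_iff]
    rintro S hS ⟨h, -⟩
    exact Finset.notMem_range_self (Finset.mem_powerset.1 hS h)
  have hsecond : ((Finset.range (m + 1)).powerset.filter
      fun S => m + 1 ∈ insert (m + 1) S ∧ broomEdgeCount k (insert (m + 1) S) = j).card =
      ((Finset.range (m + 1)).powerset.filter
        fun S => broomEdgeCount k S + (if m ∈ S then 1 else 0) = j).card := by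
    refine card_filter_powerset_range_congr fun S hS => ?_
    rw [broomEdgeCount_insert_of_eq (p := m) hS (by omega),
      and_iff_right (Finset.mem_insert_self _ _)]
  rw [card_filter_powerset_range_succ, hfirst, hsecond, zero_add,
    card_filter_powerset_range_succ, broomSubsetCount]
  congr 1
  · refine card_filter_powerset_range_congr fun S hS => ?_
    rw [if_neg fun h => Finset.notMem_range_self (hS h), add_zero]
  · simp

theorem card_insert_broomEdgeCount_eq_zero {k m : ℕ} (hm : m < k) :
    ((Finset.range m).powerset.filter fun S => broomEdgeCount k (insert m S) = 0).card =
      broomSubsetCount k (m - 1) 0 := by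
  cases m with
  | zero =>
    refine card_filter_powerset_range_congr fun S hS => ?_
    rw [broomEdgeCount_insert hS, if_neg (by omega), add_zero]
  | succ m =>
    have hcongr : ((Finset.range (m + 1)).powerset.filter
        fun S => broomEdgeCount k (insert (m + 1) S) = 0).card =
        ((Finset.range (m + 1)).powerset.filter
          fun S => broomEdgeCount k S + (if m ∈ S then 1 else 0) = 0).card :=
      card_filter_powerset_range_congr fun S hS => by
        rw [broomEdgeCount_insert_of_eq (p := m) hS (by omega)]
    rw [hcongr, card_filter_powerset_range_succ, Nat.add_sub_cancel, broomSubsetCount]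
    simp only [Finset.mem_insert_self, if_true, Nat.add_eq_zero_iff, one_ne_zero, and_false,
      Finset.filter_false, Finset.card_empty, add_zero]
    refine card_filter_powerset_range_congr fun S hS => ?_
    rw [if_neg fun h => Finset.notMem_range_self (hS h), and_iff_left rfl]

/-- For `k ≥ 2` and `n ≥ k`, the broom graph satisfies
`σ₁(Bₙᵏ) = σ₁(P_{k−1})·2^{n−k} + σ₁(P_{k−2}) + σ₀(P_{k−3}) + (n−k)·σ₀(P_{k−2})`.
(Here subtraction is truncated, which realises the conventions `σ₁(P_t) = 0` and
`σ₀(P_t) = 1` for `t ≤ 0`, since `σ₁(P₀) = 0` and `σ₀(P₀) = 1`.) -/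
theorem sigma1_broomGraph (n k : ℕ) (hk : 2 ≤ k) (hn : k ≤ n) :
    sigma1 (broomGraph n k) =
      sigma1 (SimpleGraph.pathGraph (k - 1)) * 2 ^ (n - k) +
      sigma1 (SimpleGraph.pathGraph (k - 2)) +
      sigma0 (SimpleGraph.pathGraph (k - 3)) +
      (n - k) * sigma0 (SimpleGraph.pathGraph (k - 2)) := by
  obtain ⟨m, rfl⟩ := Nat.exists_eq_add_of_le' hk
  obtain ⟨r, rfl⟩ := Nat.exists_eq_add_of_le hn
  have hk' : 1 ≤ m + 2 := by omega
  rw [pathGraph_eq_broomGraph hk' (show m + 2 - 1 ≤ m + 2 by omega),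
    pathGraph_eq_broomGraph hk' (show m + 2 - 2 ≤ m + 2 by omega),
    pathGraph_eq_broomGraph hk' (show m + 2 - 3 ≤ m + 2 by omega)]
  simp only [sigma1_broomGraph_eq_broomSubsetCount hk', sigma0_broomGraph_eq_broomSubsetCount hk']
  rw [show m + 2 - 1 = m + 1 by omega, show m + 2 - 2 = m by omega,
    show m + 2 - 3 = m - 1 by omega, Nat.add_sub_cancel_left]
  have hsplit : broomSubsetCount (m + 2) (m + 2 + r) 1 =
      ((Finset.range (m + 2 + r)).powerset.filter
        fun S => m + 1 ∈ S ∧ broomEdgeCount (m + 2) S = 1).card +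
      ((Finset.range (m + 2 + r)).powerset.filter
        fun S => m + 1 ∉ S ∧ broomEdgeCount (m + 2) S = 1).card := by
    rw [broomSubsetCount, ← Finset.card_filter_add_card_filter_not (fun S => m + 1 ∈ S)]
    simp only [Finset.filter_filter, and_comm]
  have hzero := card_mem_last (Nat.lt_succ_self (m + 1)) 0
  have hone := card_mem_last (Nat.lt_succ_self (m + 1)) 1
  simp only [Nat.succ_eq_add_one, Nat.add_eq_right,
    card_insert_broomEdgeCount_eq_zero (show m < m + 1 + 1 by omega)] at hone
  simp only [Nat.succ_eq_add_one, Nat.add_eq_zero_iff, one_ne_zero, and_false,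
    Finset.filter_false, Finset.card_empty, add_zero] at hzero
  rw [hsplit, card_mem_center_one (m + 1) r, card_notMem_center (m + 1) r 1, hone, hzero]
  ring
end

section
/- Let k ≥ 2 and n ≥ k + 1, and let Lₙᵏ be the lollipop graph: the graph of order n obtained from the path P_k by adding a complete graph K_{n−k} and joining every vertex of K_{n−k} to the same fixed end-vertex of P_k. Then σ₁(Lₙᵏ) = (n−k+1)·σ₁(P_{k−1}) + C(n−k, 2)·σ₀(P_{k−1}) + σ₁(P_{k−2}) + σ₀(P_{k−3}) + (n−k)·σ₀(P_{k−2}), where C(n−k,2) is the binomial coefficient, with the conventions σ₁(P_t) = 0 for t ≤ 0 and σ₀(P_t) = 1 for t ≤ 0. -/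
/-- The lollipop graph `Lₙᵏ`: the graph of order `n` obtained from the path `P_k`
(on vertices `0, …, k−1`) by adding a complete graph `K_{n−k}` (on vertices `k, …, n−1`)
and joining every vertex of `K_{n−k}` to the end-vertex `k−1` of the path. -/
def lollipopGraph (n k : ℕ) : SimpleGraph (Fin n) :=
  SimpleGraph.fromRel
    (fun a b => (a.val + 1 = b.val ∧ b.val < k) ∨ (k ≤ a.val ∧ k ≤ b.val) ∨
      (a.val = k - 1 ∧ k ≤ b.val))

open Finset in
theorem card_filter_powerset_insert {V : Type*} [DecidableEq V] {v : V} {A : Finset V}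
    (hv : v ∉ A) (P : Finset V → Prop) [DecidablePred P] :
    #{S ∈ (insert v A).powerset | P S} =
      #{S ∈ A.powerset | P S} + #{S ∈ A.powerset | P (insert v S)} := by
  rw [powerset_insert, filter_union, card_union_of_disjoint, filter_image, card_image_of_injOn]
  · intro S hS T hT h
    simp only [coe_filter, mem_powerset, Set.mem_ofPred_eq] at hS hT
    rw [← erase_insert (fun h' => hv (hS.1 h')), ← erase_insert (fun h' => hv (hT.1 h'))]
    exact congrArg (fun U => U.erase v) h
  · rw [disjoint_left]
    intro S hS hS'
    simp only [mem_filter, mem_powerset, mem_image] at hS hS'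
    obtain ⟨⟨T, -, rfl⟩, -⟩ := hS'
    exact hv (hS.1 (mem_insert_self v T))

theorem edgesWithin_insert {V : Type*} (G : SimpleGraph V) (v : V) (S : Set V) :
    edgesWithin G (insert v S) =
      edgesWithin G S ∪ (fun a => s(a, v)) '' {a | a ∈ S ∧ G.Adj a v} := by
  ext e
  induction e using Sym2.ind with
  | _ a b =>
    simp only [edgesWithin, Set.mem_ofPred_eq, SimpleGraph.mem_edgeSet, Sym2.mem_iff, Set.mem_union,
      Set.mem_insert_iff, forall_eq_or_imp, forall_eq, Set.mem_image, Sym2.eq_iff]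
    constructor
    · rintro ⟨h, rfl | ha, rfl | hb⟩
      · exact absurd h (G.loopless.irrefl _)
      · exact Or.inr ⟨b, ⟨hb, h.symm⟩, Or.inr ⟨rfl, rfl⟩⟩
      · exact Or.inr ⟨a, ⟨ha, h⟩, Or.inl ⟨rfl, rfl⟩⟩
      · exact Or.inl ⟨h, ha, hb⟩
    · rintro (⟨h, ha, hb⟩ | ⟨c, ⟨hc, h⟩, ⟨rfl, rfl⟩ | ⟨rfl, rfl⟩⟩)
      · exact ⟨h, Or.inr ha, Or.inr hb⟩
      · exact ⟨h, Or.inr hc, Or.inl rfl⟩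
      · exact ⟨h.symm, Or.inl rfl, Or.inr hc⟩

theorem finite_edgesWithin {V : Type*} (G : SimpleGraph V) {S : Set V} (hS : S.Finite) :
    (edgesWithin G S).Finite := by
  refine ((hS.prod hS).image (fun p : V × V => s(p.1, p.2))).subset ?_
  intro e he
  induction e using Sym2.ind with
  | _ a b => exact ⟨(a, b), ⟨he.2 a (by simp), he.2 b (by simp)⟩, rfl⟩

open Finset in
theorem ncard_edgesWithin_insert {V : Type*} [DecidableEq V] (G : SimpleGraph V)
    [DecidableRel G.Adj] {v : V} {S : Finset V}
    (hv : v ∉ S) :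
    (edgesWithin G (insert v S : Finset V)).ncard =
      (edgesWithin G S).ncard + #{a ∈ S | G.Adj a v} := by
  have hfin : {a | a ∈ (S : Set V) ∧ G.Adj a v}.Finite :=
    S.finite_toSet.subset fun a ha => ha.1
  rw [coe_insert, edgesWithin_insert, Set.ncard_union_eq _ (finite_edgesWithin G S.finite_toSet)
    (hfin.image _), Set.ncard_image_of_injective, ← Set.ncard_coe_finset]
  · congr 2
    ext a
    simp
  · intro a b h
    rcases Sym2.eq_iff.1 h with ⟨h, -⟩ | ⟨h, h'⟩
    exacts [h, h.trans h']
  · rw [Set.disjoint_left]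
    rintro _ he ⟨a, -, rfl⟩
    exact hv (he.2 v (by simp))

theorem ncard_edgesWithin_comap {V W : Type*} (G : SimpleGraph W) (f : V ↪ W) (S : Set V) :
    (edgesWithin (G.comap f) S).ncard = (edgesWithin G (f '' S)).ncard := by
  rw [← Set.ncard_image_of_injective _ (Sym2.map.injective f.injective)]
  congr 1
  ext e
  constructor
  · rintro ⟨e, he, rfl⟩
    induction e using Sym2.ind with
    | _ a b => simpa [edgesWithin] using he
  · induction e using Sym2.ind with
    | _ a b =>
      rintro ⟨h, hS⟩
      obtain ⟨a, ha, rfl⟩ := hS a (by simp)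
      obtain ⟨b, hb, rfl⟩ := hS b (by simp)
      exact ⟨s(a, b), ⟨h, by simp [ha, hb]⟩, rfl⟩

open Finset in
/-- The number of subsets of `A` inducing a subgraph of `G` with exactly `j` edges. -/
noncomputable def numSubsetsWithEdges {V : Type*} (G : SimpleGraph V) (A : Finset V) (j : ℕ) : ℕ :=
  #{S ∈ A.powerset | (edgesWithin G ((S : Finset V) : Set V)).ncard = j}

theorem card_ncard_edgesWithin_comap_eq {V W : Type*} [Fintype V] (G : SimpleGraph W) (f : V ↪ W)
    (j : ℕ) :
    Nat.card {S : Set V | (edgesWithin (G.comap f) S).ncard = j} =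
      numSubsetsWithEdges G (Finset.univ.map f) j := by
  classical
  rw [numSubsetsWithEdges, Nat.card_coe_set_eq, ← Set.ncard_coe_finset]
  refine Set.ncard_congr (fun S _ => S.toFinset.map f) ?_ ?_ ?_
  · intro S hS
    have := ncard_edgesWithin_comap G f S
    simp_all [Finset.map_subset_map]
  · intro S T _ _ h
    exact Set.toFinset_inj.1 (Finset.map_injective f h)
  · intro T hT
    simp only [Finset.coe_filter, Finset.mem_powerset, Set.mem_ofPred_eq] at hT
    obtain ⟨U, -, rfl⟩ := Finset.subset_map_iff.1 hT.1
    refine ⟨U, ?_, by simp⟩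
    rw [Set.mem_ofPred_eq, ncard_edgesWithin_comap, ← hT.2, Finset.coe_map]

theorem sigma1_comap {V W : Type*} [Fintype V] (G : SimpleGraph W) (f : V ↪ W) :
    sigma1 (G.comap f) = numSubsetsWithEdges G (Finset.univ.map f) 1 :=
  card_ncard_edgesWithin_comap_eq G f 1

theorem sigma0_comap {V W : Type*} [Fintype V] (G : SimpleGraph W) (f : V ↪ W) :
    sigma0 (G.comap f) = numSubsetsWithEdges G (Finset.univ.map f) 0 := by
  rw [← card_ncard_edgesWithin_comap_eq, sigma0]
  congr! 5 with S
  exact (Set.ncard_eq_zero (finite_edgesWithin _ S.toFinite)).symm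

/-- The union of the lollipop graphs `lollipopGraph n k` over all `n`, on the vertex set `ℕ`. -/
def infiniteLollipop (k : ℕ) : SimpleGraph ℕ :=
  SimpleGraph.fromRel
    (fun a b => (a + 1 = b ∧ b < k) ∨ (k ≤ a ∧ k ≤ b) ∨ (a = k - 1 ∧ k ≤ b))

theorem lollipopGraph_eq_comap (n k : ℕ) :
    lollipopGraph n k = (infiniteLollipop k).comap Fin.valEmbedding := by
  ext a b
  simp [lollipopGraph, infiniteLollipop, Fin.ext_iff]

theorem pathGraph_eq_comap {t k : ℕ} (h : t ≤ k) :
    SimpleGraph.pathGraph t = (infiniteLollipop k).comap Fin.valEmbedding := by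
  ext a b
  simp only [SimpleGraph.pathGraph_adj, infiniteLollipop, SimpleGraph.comap_adj,
    SimpleGraph.fromRel_adj, Fin.valEmbedding_apply]
  omega

theorem univ_map_valEmbedding (n : ℕ) :
    (Finset.univ : Finset (Fin n)).map Fin.valEmbedding = Finset.range n := by
  ext a
  simp only [Finset.mem_map, Finset.mem_univ, true_and, Fin.valEmbedding_apply, Finset.mem_range]
  exact ⟨fun ⟨i, hi⟩ => hi ▸ i.isLt, fun h => ⟨⟨a, h⟩, rfl⟩⟩

theorem infiniteLollipop_adj_of_lt {k a v : ℕ} (h : a < v) :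
    (infiniteLollipop k).Adj a v ↔ (a + 1 = v ∧ v < k) ∨ (k - 1 ≤ a ∧ k ≤ v) := by
  simp only [infiniteLollipop, SimpleGraph.fromRel_adj]
  omega

open Finset in
theorem ncard_edgesWithin_insert_of_lt {k v : ℕ} {S : Finset ℕ} (hS : S ⊆ range (v + 1))
    (hv : v + 1 < k) :
    (edgesWithin (infiniteLollipop k) (insert (v + 1) S : Finset ℕ)).ncard =
      (edgesWithin (infiniteLollipop k) S).ncard + if v ∈ S then 1 else 0 := by
  classical
  rw [ncard_edgesWithin_insert _ (fun h => by simpa using hS h)]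
  congr 1
  have hcard : (if v ∈ S then 1 else 0) = #{a ∈ S | a = v} := by
    rw [filter_eq']
    split_ifs <;> rfl
  rw [hcard]
  refine congrArg card (filter_congr fun a ha => ?_)
  rw [infiniteLollipop_adj_of_lt (mem_range.1 (hS ha))]
  omega

open Finset in
theorem ncard_edgesWithin_insert_of_le {k v : ℕ} {S : Finset ℕ} (hS : S ⊆ range v)
    (hv : k ≤ v) :
    (edgesWithin (infiniteLollipop k) (insert v S : Finset ℕ)).ncard =
      (edgesWithin (infiniteLollipop k) S).ncard + #{a ∈ S | k - 1 ≤ a} := by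
  classical
  rw [ncard_edgesWithin_insert _ (fun h => by simpa using hS h)]
  congr 2
  refine filter_congr fun a ha => ?_
  rw [infiniteLollipop_adj_of_lt (mem_range.1 (hS ha))]
  omega

open Finset in
theorem card_filter_notMem_top {G : SimpleGraph ℕ} (r j : ℕ) :
    #{S ∈ (range (r + 1)).powerset | (edgesWithin G ((S : Finset ℕ) : Set ℕ)).ncard = j ∧ r ∉ S} =
      numSubsetsWithEdges G (range r) j := by
  rw [range_add_one, card_filter_powerset_insert (by simp), numSubsetsWithEdges]
  simp only [mem_insert_self, not_true_eq_false, and_false, filter_false, card_empty, add_zero]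
  congr 1
  refine filter_congr fun S hS => ?_
  have : r ∉ S := fun h => by simpa using mem_powerset.1 hS h
  simp [this]

open Finset in
theorem card_filter_count_top_eq_zero {G : SimpleGraph ℕ} {m n : ℕ} (h : m ≤ n) (j : ℕ) :
    #{S ∈ (range n).powerset | (edgesWithin G ((S : Finset ℕ) : Set ℕ)).ncard = j ∧ #{a ∈ S | m ≤ a} = 0} =
      numSubsetsWithEdges G (range m) j := by
  rw [numSubsetsWithEdges]
  congr 1
  ext S
  simp only [mem_filter, mem_powerset, card_eq_zero, filter_eq_empty_iff, not_le]
  constructor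
  · rintro ⟨-, hj, hS⟩
    exact ⟨fun a ha => mem_range.2 (hS ha), hj⟩
  · rintro ⟨hS, hj⟩
    exact ⟨hS.trans (range_mono h), hj, fun a ha => mem_range.1 (hS ha)⟩

open Finset in
theorem numSubsetsWithEdges_path_one (r : ℕ) :
    numSubsetsWithEdges (infiniteLollipop (r + 2)) (range (r + 2)) 1 =
      numSubsetsWithEdges (infiniteLollipop (r + 2)) (range (r + 1)) 1 +
      numSubsetsWithEdges (infiniteLollipop (r + 2)) (range r) 1 +
      numSubsetsWithEdges (infiniteLollipop (r + 2)) (range (r - 1)) 0 := by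
  conv_lhs => rw [numSubsetsWithEdges, range_add_one, card_filter_powerset_insert (by simp)]
  rw [← numSubsetsWithEdges, add_assoc]
  congr 1
  rw [← card_filter_notMem_top, range_add_one, card_filter_powerset_insert (by simp),
    card_filter_powerset_insert (by simp)]
  simp only [mem_insert_self, not_true_eq_false, and_false, filter_false, card_empty, add_zero]
  congr 1
  · congr 1
    refine filter_congr fun S hS => ?_
    have hS := mem_powerset.1 hS
    have hr : r ∉ S := fun h => by simpa using hS h
    rw [ncard_edgesWithin_insert_of_lt (hS.trans (range_mono (by omega))) (by omega)]
    simp [hr]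
  · cases r with
    | zero =>
      classical
      rw [numSubsetsWithEdges]
      congr 1
      refine filter_congr fun S hS => ?_
      have hS := mem_powerset.1 hS
      rw [ncard_edgesWithin_insert_of_lt (insert_subset (by simp) (hS.trans (by simp))) (by omega),
        ncard_edgesWithin_insert _ (fun h => by simpa using hS h)]
      have : S = ∅ := by simpa using hS
      simp [this]
    | succ q =>
      rw [Nat.add_sub_cancel, ← card_filter_notMem_top]
      congr 1
      refine filter_congr fun S hS => ?_
      have hS := mem_powerset.1 hS
      rw [ncard_edgesWithin_insert_of_lt
        (insert_subset (by simp) (hS.trans (range_mono (by omega)))) (by omega),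
        ncard_edgesWithin_insert_of_lt hS (by omega)]
      by_cases hq : q ∈ S <;> simp [hq]

open Finset in
theorem card_independent_count_top_eq_one (r m : ℕ) :
    #{S ∈ (range (r + 2 + m)).powerset |
        (edgesWithin (infiniteLollipop (r + 2)) ((S : Finset ℕ) : Set ℕ)).ncard = 0 ∧
          #{a ∈ S | r + 1 ≤ a} = 1} =
      numSubsetsWithEdges (infiniteLollipop (r + 2)) (range r) 0 +
      m * numSubsetsWithEdges (infiniteLollipop (r + 2)) (range (r + 1)) 0 := by
  induction m with
  | zero =>
    rw [add_zero, range_add_one, card_filter_powerset_insert (by simp), ← card_filter_notMem_top,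
      filter_false_of_mem, card_empty, zero_add, zero_mul, add_zero]
    · congr 1
      refine filter_congr fun S hS => ?_
      have hS := mem_powerset.1 hS
      have h0 : #{a ∈ S | r + 1 ≤ a} = 0 := by
        simp only [card_eq_zero, filter_eq_empty_iff, not_le]
        exact fun a ha => mem_range.1 (hS ha)
      rw [ncard_edgesWithin_insert_of_lt hS (by omega), filter_insert, if_pos le_rfl,
        card_insert_of_notMem (fun h => by simpa using hS (mem_filter.1 h).1), h0]
      by_cases hr : r ∈ S <;> simp [hr]
    · rintro S hS ⟨-, h⟩
      have hS := mem_powerset.1 hS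
      rw [filter_false_of_mem (fun a ha => not_le.2 (mem_range.1 (hS ha)))] at h
      simp at h
  | succ m ih =>
    rw [← add_assoc, range_add_one, card_filter_powerset_insert (by simp), ih, add_mul, one_mul,
      ← add_assoc, ← card_filter_count_top_eq_zero (show r + 1 ≤ r + 2 + m by omega)]
    congr 2
    refine filter_congr fun S hS => ?_
    have hS := mem_powerset.1 hS
    rw [ncard_edgesWithin_insert_of_le hS (by omega), filter_insert, if_pos (by omega),
      card_insert_of_notMem (fun h => by simpa using hS (mem_filter.1 h).1)]
    rw [show r + 2 - 1 = r + 1 from rfl]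
    omega

open Finset in
theorem numSubsetsWithEdges_add_one_one (r m : ℕ) :
    numSubsetsWithEdges (infiniteLollipop (r + 2)) (range (r + 2 + (m + 1))) 1 =
      numSubsetsWithEdges (infiniteLollipop (r + 2)) (range (r + 2 + m)) 1 +
      (numSubsetsWithEdges (infiniteLollipop (r + 2)) (range (r + 1)) 1 +
      (numSubsetsWithEdges (infiniteLollipop (r + 2)) (range r) 0 +
      m * numSubsetsWithEdges (infiniteLollipop (r + 2)) (range (r + 1)) 0)) := by
  rw [← card_independent_count_top_eq_one, ← add_assoc (r + 2) m 1]
  conv_lhs => rw [numSubsetsWithEdges, range_add_one, card_filter_powerset_insert (by simp)]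
  rw [← numSubsetsWithEdges, ← card_filter_count_top_eq_zero (show r + 1 ≤ r + 2 + m by omega),
    ← card_union_of_disjoint, ← filter_or]
  · congr 2
    refine filter_congr fun S hS => ?_
    rw [ncard_edgesWithin_insert_of_le (mem_powerset.1 hS) (by omega),
      show r + 2 - 1 = r + 1 from rfl]
    omega
  · rw [disjoint_filter]
    omega

open Finset in
theorem numSubsetsWithEdges_infiniteLollipop_one (r m : ℕ) :
    numSubsetsWithEdges (infiniteLollipop (r + 2)) (range (r + 2 + m)) 1 =
      (m + 1) * numSubsetsWithEdges (infiniteLollipop (r + 2)) (range (r + 1)) 1 +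
      m.choose 2 * numSubsetsWithEdges (infiniteLollipop (r + 2)) (range (r + 1)) 0 +
      numSubsetsWithEdges (infiniteLollipop (r + 2)) (range r) 1 +
      numSubsetsWithEdges (infiniteLollipop (r + 2)) (range (r - 1)) 0 +
      m * numSubsetsWithEdges (infiniteLollipop (r + 2)) (range r) 0 := by
  induction m with
  | zero => simp [numSubsetsWithEdges_path_one]
  | succ m ih =>
    rw [numSubsetsWithEdges_add_one_one, ih, Nat.choose_succ_succ' m 1, Nat.choose_one_right]
    ring

/-- For `k ≥ 2` and `n ≥ k + 1`, the lollipop graph satisfies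
`σ₁(Lₙᵏ) = (n−k+1)·σ₁(P_{k−1}) + C(n−k,2)·σ₀(P_{k−1}) + σ₁(P_{k−2}) + σ₀(P_{k−3})
  + (n−k)·σ₀(P_{k−2})`.
(Here subtraction is truncated, which realises the conventions `σ₁(P_t) = 0` and
`σ₀(P_t) = 1` for `t ≤ 0`, since `σ₁(P₀) = 0` and `σ₀(P₀) = 1`.) -/
theorem sigma1_lollipopGraph (n k : ℕ) (hk : 2 ≤ k) (hn : k + 1 ≤ n) :
    sigma1 (lollipopGraph n k) =
      (n - k + 1) * sigma1 (SimpleGraph.pathGraph (k - 1)) +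
      Nat.choose (n - k) 2 * sigma0 (SimpleGraph.pathGraph (k - 1)) +
      sigma1 (SimpleGraph.pathGraph (k - 2)) +
      sigma0 (SimpleGraph.pathGraph (k - 3)) +
      (n - k) * sigma0 (SimpleGraph.pathGraph (k - 2)) := by
  obtain ⟨r, rfl⟩ := Nat.exists_eq_add_of_le' hk
  obtain ⟨m, rfl⟩ := Nat.exists_eq_add_of_le (Nat.le_of_succ_le hn)
  rw [lollipopGraph_eq_comap, pathGraph_eq_comap (show r + 2 - 1 ≤ r + 2 by omega),
    pathGraph_eq_comap (show r + 2 - 2 ≤ r + 2 by omega),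
    pathGraph_eq_comap (show r + 2 - 3 ≤ r + 2 by omega)]
  simp only [sigma1_comap, sigma0_comap, univ_map_valEmbedding, Nat.add_sub_cancel_left]
  exact numSubsetsWithEdges_infiniteLollipop_one r m
end

section
/- If G is a connected finite simple graph with m edges, then σ₁(G) ≥ m, with equality if and only if G is a good graph (every edge uv of G satisfies N[u] ∪ N[v] = V(G)). -/
/-- A graph is good if every edge `uv` satisfies `N[u] ∪ N[v] = V(G)`, i.e. the union of
the closed neighbourhoods of the two endpoints is the whole vertex set. -/
def GoodGraph {V : Type*} (G : SimpleGraph V) : Prop :=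
  ∀ ⦃u v : V⦄, G.Adj u v →
    insert u (G.neighborSet u) ∪ insert v (G.neighborSet v) = Set.univ

theorem edgesWithin_mem {V : Type*} {G : SimpleGraph V} {e : Sym2 V} (he : e ∈ G.edgeSet) :
    edgesWithin G {v | v ∈ e} = {e} := by
  ext f
  refine ⟨?_, ?_⟩
  · induction f with | _ a b =>
    rintro ⟨hab, hf⟩
    exact ((Sym2.mem_and_mem_iff (G.ne_of_adj hab)).1
      ⟨hf a (Sym2.mem_mk_left a b), hf b (Sym2.mem_mk_right a b)⟩).symm
  · rintro rfl
    exact ⟨he, fun _ h => h⟩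

/-- The endpoint sets of edges are 1-nearly independent. -/
theorem image_edgeSet_subset {V : Type*} (G : SimpleGraph V) :
    (fun e : Sym2 V => {v | v ∈ e}) '' G.edgeSet ⊆
      {S : Set V | (edgesWithin G S).ncard = 1} := by
  rintro _ ⟨e, he, rfl⟩
  exact Set.ncard_eq_one.2 ⟨e, edgesWithin_mem he⟩

theorem ncard_image_edgeSet {V : Type*} (G : SimpleGraph V) :
    ((fun e : Sym2 V => {v | v ∈ e}) '' G.edgeSet).ncard = G.edgeSet.ncard :=
  Set.ncard_image_of_injective _ fun _ _ h => Sym2.ext fun x => Set.ext_iff.1 h x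

/-- In a good graph every 1-nearly independent set is the endpoint set of an edge. -/
theorem GoodGraph.subset_image_edgeSet {V : Type*} {G : SimpleGraph V} (h : GoodGraph G) :
    {S : Set V | (edgesWithin G S).ncard = 1} ⊆
      (fun e : Sym2 V => {v | v ∈ e}) '' G.edgeSet := by
  intro S hS
  obtain ⟨e, he⟩ := Set.ncard_eq_one.1 hS
  have heS : e ∈ edgesWithin G S := he ▸ rfl
  refine ⟨e, heS.1, Set.Subset.antisymm (fun v hv => heS.2 v hv) fun w hw => ?_⟩
  have key : ∀ x ∈ e, G.Adj x w → w ∈ e := by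
    intro x hx hxw
    have hmem : s(x, w) ∈ edgesWithin G S := by
      refine ⟨hxw, fun v hv => ?_⟩
      rcases Sym2.mem_iff.1 hv with rfl | rfl
      · exact heS.2 _ hx
      · exact hw
    rw [he, Set.mem_singleton_iff] at hmem
    exact hmem ▸ Sym2.mem_mk_right x w
  induction e with | _ u v =>
  have hw' : w ∈ insert u (G.neighborSet u) ∪ insert v (G.neighborSet v) :=
    h heS.1 ▸ Set.mem_univ w
  rcases hw' with (rfl | hu) | (rfl | hv)
  · exact Sym2.mem_mk_left _ _
  · exact key u (Sym2.mem_mk_left _ _) hu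
  · exact Sym2.mem_mk_right _ _
  · exact key v (Sym2.mem_mk_right _ _) hv

/-- If every 1-nearly independent set is the endpoint set of an edge, the graph is good. -/
theorem GoodGraph.of_subset_image_edgeSet {V : Type*} {G : SimpleGraph V}
    (h : {S : Set V | (edgesWithin G S).ncard = 1} ⊆
      (fun e : Sym2 V => {v | v ∈ e}) '' G.edgeSet) : GoodGraph G := by
  intro u v huv
  refine Set.eq_univ_of_forall fun w => ?_
  by_contra hw
  simp only [Set.mem_union, Set.mem_insert_iff, SimpleGraph.mem_neighborSet, not_or] at hw
  obtain ⟨⟨hwu, hu⟩, hwv, hv⟩ := hw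
  have hS : edgesWithin G {u, v, w} = {s(u, v)} := by
    ext f
    refine ⟨?_, ?_⟩
    · induction f with | _ a b =>
      rintro ⟨hab, hf⟩
      have ha := hf a (Sym2.mem_mk_left a b)
      have hb := hf b (Sym2.mem_mk_right a b)
      rw [SimpleGraph.mem_edgeSet] at hab
      simp only [Set.mem_insert_iff, Set.mem_singleton_iff] at ha hb
      rcases ha with rfl | rfl | rfl <;> rcases hb with rfl | rfl | rfl <;>
        simp_all [G.adj_comm]
    · rintro rfl
      exact ⟨huv, by simp⟩
  obtain ⟨e, he, heS⟩ := h (show (edgesWithin G {u, v, w}).ncard = 1 by simp [hS])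
  have heq : ({e} : Set (Sym2 V)) = {s(u, v)} := by
    rw [← edgesWithin_mem he, ← hS]
    exact congrArg _ heS
  have hwe : w ∈ e := (Set.ext_iff.1 heS w).2 (by simp)
  rw [Set.singleton_injective heq, Sym2.mem_iff] at hwe
  exact hwe.elim hwu hwv

/-- If `G` is a connected finite simple graph with `m` edges, then `σ₁(G) ≥ m`, with
equality if and only if `G` is a good graph. -/
theorem sigma1_ge_edge_count {V : Type*} [Fintype V] (G : SimpleGraph V)
    (hG : G.Connected) :
    G.edgeSet.ncard ≤ sigma1 G ∧ (sigma1 G = G.edgeSet.ncard ↔ GoodGraph G) := by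
  rw [sigma1, Nat.card_coe_set_eq, ← ncard_image_edgeSet G]
  have hsub := image_edgeSet_subset G
  refine ⟨Set.ncard_le_ncard hsub (Set.toFinite _), fun h => ?_, fun h => ?_⟩
  · exact .of_subset_image_edgeSet (Set.eq_of_subset_of_ncard_le hsub h.le (Set.toFinite _)).ge
  · rw [hsub.antisymm h.subset_image_edgeSet]
end

section
/- If G is a connected finite simple graph of order n, then σ₁(G) ≥ n − 1, with equality if and only if G is isomorphic to the star K_{1,n−1}. -/
/-- The star `K_{1,n−1}` on `n` vertices: the centre `0` is adjacent to the `n−1`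
leaves `1, …, n−1`, and there are no other edges. -/
def starGraph (n : ℕ) : SimpleGraph (Fin n) :=
  SimpleGraph.fromRel (fun a _ => a.val = 0)

theorem edgesWithin_setOf_mem {V : Type*} (G : SimpleGraph V) {e : Sym2 V} (he : e ∈ G.edgeSet) :
    edgesWithin G {v | v ∈ e} = {e} := by
  ext f
  induction e with | _ a b
  induction f with | _ c d
  simp only [edgesWithin, Set.mem_ofPred_eq, Sym2.mem_iff, forall_eq_or_imp, forall_eq,
    Set.mem_singleton_iff, Sym2.eq_iff, SimpleGraph.mem_edgeSet] at he ⊢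
  have := G.adj_comm
  have := G.loopless.irrefl
  grind

theorem setOf_mem_sym2_injective {V : Type*} :
    Function.Injective fun e : Sym2 V => {v | v ∈ e} := fun _ _ h =>
  Sym2.ext fun v => Set.ext_iff.mp h v

theorem ncard_edgeSet_le_sigma1 {V : Type*} [Finite V] (G : SimpleGraph V) :
    G.edgeSet.ncard ≤ sigma1 G := by
  rw [← Set.ncard_image_of_injective _ setOf_mem_sym2_injective]
  exact Set.ncard_le_ncard (image_edgeSet_subset G)

theorem adj_or_adj_of_sigma1_le {V : Type*} [Finite V] {G : SimpleGraph V}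
    (h : sigma1 G ≤ G.edgeSet.ncard) {u v w : V} (huv : G.Adj u v) (hu : w ≠ u) (hv : w ≠ v) :
    G.Adj u w ∨ G.Adj v w := by
  by_contra! hw
  have heq := Set.eq_of_subset_of_ncard_le (image_edgeSet_subset G)
    (by rwa [Set.ncard_image_of_injective _ setOf_mem_sym2_injective])
  have hmem : ({u, v, w} : Set V) ∈ {S : Set V | (edgesWithin G S).ncard = 1} := by
    refine Set.ncard_eq_one.mpr ⟨s(u, v), ?_⟩
    ext e
    induction e with | _ a b
    have := G.adj_comm
    have := G.loopless.irrefl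
    simp only [edgesWithin, Set.mem_ofPred_eq, Sym2.forall_mem_pair, Set.mem_singleton_iff,
      Sym2.eq_iff, SimpleGraph.mem_edgeSet, Set.mem_insert_iff]
    clear heq
    grind
  rw [← heq] at hmem
  obtain ⟨e, -, he⟩ := hmem
  induction e with | _ a b
  have hx : ∀ x, (x = a ∨ x = b) ↔ (x = u ∨ x = v ∨ x = w) := fun x => by
    simpa using Set.ext_iff.mp he x
  have := huv.ne
  have := hx u
  have := hx v
  have := hx w
  clear heq he
  grind

theorem starGraph_adj {n : ℕ} (a b : Fin n) :
    (starGraph n).Adj a b ↔ a ≠ b ∧ (a.val = 0 ∨ b.val = 0) :=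
  SimpleGraph.fromRel_adj _ a b

theorem nonempty_iso_starGraph_iff {V : Type*} [Fintype V] [Nonempty V] (G : SimpleGraph V) :
    Nonempty (G ≃g starGraph (Fintype.card V)) ↔
      ∃ c, ∀ a b, G.Adj a b ↔ a ≠ b ∧ (a = c ∨ b = c) := by
  have hpos : 0 < Fintype.card V := Fintype.card_pos
  constructor
  · rintro ⟨e⟩
    refine ⟨e.symm ⟨0, hpos⟩, fun a b => ?_⟩
    have hc : ∀ x, x = e.symm ⟨0, hpos⟩ ↔ (e x).val = 0 := fun x => by
      rw [← e.injective.eq_iff, e.apply_symm_apply, Fin.ext_iff]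
    rw [← e.map_adj_iff, starGraph_adj, hc, hc, e.injective.ne_iff]
  · rintro ⟨c, hc⟩
    classical
    let f := (Fintype.equivFin V).trans (Equiv.swap (Fintype.equivFin V c) ⟨0, hpos⟩)
    have hf : ∀ x, (f x).val = 0 ↔ x = c := fun x => by
      have : f c = ⟨0, hpos⟩ := by simp [f]
      rw [← f.injective.eq_iff, this, Fin.ext_iff]
    exact ⟨f, fun {a b} => by
      rw [starGraph_adj, hf, hf, f.injective.ne_iff, hc]⟩

theorem sigma1_le_of_forall_adj_iff {V : Type*} [Fintype V] {G : SimpleGraph V} {c : V}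
    (hc : ∀ a b, G.Adj a b ↔ a ≠ b ∧ (a = c ∨ b = c)) : sigma1 G ≤ Fintype.card V - 1 := by
  have hsub : {S : Set V | (edgesWithin G S).ncard = 1} ⊆ (fun w => {c, w}) '' ({c}ᶜ : Set V) := by
    intro S hS
    obtain ⟨e, he⟩ := Set.ncard_eq_one.mp hS
    induction e with | _ a b
    have hmem : ∀ x y, (G.Adj x y ∧ x ∈ S ∧ y ∈ S) ↔ (x = a ∧ y = b ∨ x = b ∧ y = a) :=
      fun x y => by simpa [edgesWithin] using Set.ext_iff.mp he s(x, y)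
    obtain ⟨hab, ha, hb⟩ := (hmem a b).mpr (.inl ⟨rfl, rfl⟩)
    have key : ∀ w, w ≠ c → c ∈ S → w ∈ S → {c, w} = S := fun w hw hcS hwS => by
      ext x
      simp only [Set.mem_insert_iff, Set.mem_singleton_iff]
      have := hmem c w
      have := hmem c x
      grind
    rcases (hc a b).mp hab with ⟨hne, rfl | rfl⟩
    · exact ⟨b, hne.symm, key b hne.symm ha hb⟩
    · exact ⟨a, hne, key a hne hb ha⟩
  calc sigma1 G ≤ ((fun w => ({c, w} : Set V)) '' ({c}ᶜ : Set V)).ncard := Set.ncard_le_ncard hsub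
    _ ≤ ({c}ᶜ : Set V).ncard := Set.ncard_image_le
    _ = Fintype.card V - 1 := by
      rw [Set.ncard_compl, Set.ncard_singleton, Nat.card_eq_fintype_card]

theorem exists_forall_adj_iff_of_sigma1_eq {V : Type*} [Fintype V] {G : SimpleGraph V}
    (hG : G.Connected) (h : sigma1 G = Fintype.card V - 1) :
    ∃ c, ∀ a b, G.Adj a b ↔ a ≠ b ∧ (a = c ∨ b = c) := by
  classical
  have hE := hG.card_vert_le_card_edgeSet_add_one
  have hle := ncard_edgeSet_le_sigma1 G
  rw [← Nat.card_coe_set_eq] at hle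
  rw [Nat.card_eq_fintype_card (α := V)] at hE
  have := hG.nonempty
  have hpos : 0 < Fintype.card V := Fintype.card_pos
  have hT : G.IsTree := SimpleGraph.isTree_iff_connected_and_card.mpr
    ⟨hG, by rw [Nat.card_eq_fintype_card (α := V)]; omega⟩
  rcases subsingleton_or_nontrivial V with hV | hV
  · exact ⟨Classical.arbitrary V, fun a b => by simp [Subsingleton.elim a b]⟩
  obtain ⟨v, hv⟩ := hT.exists_vert_degree_one_of_nontrivial
  obtain ⟨u, hvu, hu⟩ := SimpleGraph.degree_eq_one_iff_existsUnique_adj.mp hv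
  have hadj : ∀ w, w ≠ u → G.Adj u w := fun w hw => by
    by_cases hwv : w = v
    · exact hwv ▸ hvu.symm
    · exact (adj_or_adj_of_sigma1_le (by rw [← Nat.card_coe_set_eq]; omega) hvu hwv hw).elim
        (fun h => absurd (hu w h) hw) id
  refine ⟨u, fun a b => ⟨fun hab => ⟨hab.ne, ?_⟩, ?_⟩⟩
  · by_contra! hn
    exact hT.isAcyclic.cliqueFree le_rfl {u, a, b}
      (SimpleGraph.is3Clique_triple_iff.mpr ⟨hadj a hn.1, hadj b hn.2, hab⟩)
  · rintro ⟨hne, rfl | rfl⟩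
    · exact hadj b hne.symm
    · exact (hadj a hne).symm

/-- If `G` is a connected finite simple graph of order `n`, then `σ₁(G) ≥ n − 1`, with
equality if and only if `G` is isomorphic to the star `K_{1,n−1}`. -/
theorem sigma1_ge_card_sub_one {V : Type*} [Fintype V] (G : SimpleGraph V)
    (hG : G.Connected) :
    Fintype.card V - 1 ≤ sigma1 G ∧
      (sigma1 G = Fintype.card V - 1 ↔ Nonempty (G ≃g starGraph (Fintype.card V))) := by
  have := hG.nonempty
  have hE := hG.card_vert_le_card_edgeSet_add_one
  rw [Nat.card_eq_fintype_card (α := V), Nat.card_coe_set_eq] at hE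
  have hle := ncard_edgeSet_le_sigma1 G
  refine ⟨by omega, ?_⟩
  rw [nonempty_iso_starGraph_iff]
  refine ⟨exists_forall_adj_iff_of_sigma1_eq hG, fun ⟨c, hc⟩ => ?_⟩
  have := sigma1_le_of_forall_adj_iff hc
  omega
end

section
/- If G is a finite simple graph of order n ≥ 6, then σ₁(G) ≤ (27/64)·2ⁿ, with equality if and only if G is isomorphic to 3K₂ ∪ (n−6)K₁ (three disjoint edges together with n−6 isolated vertices) or to 4K₂ ∪ (n−8)K₁ (four disjoint edges together with n−8 isolated vertices, the latter only possible when n ≥ 8). -/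
/-- The graph `aK₂ ∪ bK₁` on `2a + b` vertices: `a` disjoint edges
`{0,1}, {2,3}, …, {2a−2, 2a−1}` together with `b` isolated vertices. -/
def matchingUnion (a b : ℕ) : SimpleGraph (Fin (2 * a + b)) :=
  SimpleGraph.fromRel
    (fun x y => x.val % 2 = 0 ∧ x.val + 1 = y.val ∧ y.val < 2 * a)

section Counting

open scoped Classical

variable {V : Type*} (G : SimpleGraph V)

/-- `T` spans no edge of `G`. -/
def Edgeless (T : Finset V) : Prop :=
  ∀ x ∈ T, ∀ y ∈ T, ¬ G.Adj x y

/-- `T` spans exactly one edge of `G`. -/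
def SpansOneEdge (T : Finset V) : Prop :=
  ∃ x ∈ T, ∃ y ∈ T, G.Adj x y ∧
    ∀ a ∈ T, ∀ b ∈ T, G.Adj a b → (a = x ∧ b = y) ∨ (a = y ∧ b = x)

/-- The number of independent subsets of `U`. -/
noncomputable def indepCount (U : Finset V) : ℕ :=
  (U.powerset.filter (Edgeless G)).card

/-- The number of subsets of `U` spanning exactly one edge. -/
noncomputable def oneEdgeCount (U : Finset V) : ℕ :=
  (U.powerset.filter (SpansOneEdge G)).card

/-- The neighbours of `v` in `U`. -/
noncomputable def nbrs (v : V) (U : Finset V) : Finset V := U.filter (G.Adj v)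

/-- The non-neighbours of `v` in `U`. -/
noncomputable def nonNbrs (v : V) (U : Finset V) : Finset V := U.filter (fun x => ¬ G.Adj v x)

lemma mem_nbrs {v x : V} {U : Finset V} : x ∈ nbrs G v U ↔ x ∈ U ∧ G.Adj v x := by
  simp [nbrs]

lemma mem_nonNbrs {v x : V} {U : Finset V} : x ∈ nonNbrs G v U ↔ x ∈ U ∧ ¬ G.Adj v x := by
  simp [nonNbrs]

lemma card_nbrs_add_card_nonNbrs (v : V) (U : Finset V) :
    (nbrs G v U).card + (nonNbrs G v U).card = U.card :=
  Finset.card_filter_add_card_filter_not _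

lemma edgeless_insert {v : V} {T : Finset V} :
    Edgeless G (insert v T) ↔ Edgeless G T ∧ ∀ x ∈ T, ¬ G.Adj v x := by
  simp only [Edgeless, Finset.mem_insert]
  constructor
  · intro h
    exact ⟨fun x hx y hy => h x (.inr hx) y (.inr hy), fun x hx => h v (.inl rfl) x (.inr hx)⟩
  · rintro ⟨h₁, h₂⟩ x (rfl | hx) y (rfl | hy)
    · exact G.loopless.irrefl _
    · exact h₂ y hy
    · exact fun h => h₂ x hx h.symm
    · exact h₁ x hx y hy

lemma spansOneEdge_insert {v : V} {T : Finset V} (hv : v ∉ T) :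
    SpansOneEdge G (insert v T) ↔
      (SpansOneEdge G T ∧ ∀ x ∈ T, ¬ G.Adj v x) ∨
        ∃ u ∈ T, G.Adj v u ∧ Edgeless G T ∧ ∀ x ∈ T, G.Adj v x → x = u := by
  constructor
  · rintro ⟨x, hx, y, hy, hxy, h⟩
    have key : ∀ u, u ∈ insert v T → G.Adj v u →
        (∀ a ∈ insert v T, ∀ b ∈ insert v T, G.Adj a b → (a = v ∧ b = u) ∨ (a = u ∧ b = v)) →
        ∃ u ∈ T, G.Adj v u ∧ Edgeless G T ∧ ∀ x ∈ T, G.Adj v x → x = u := by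
      intro u hu hvu h
      have huT : u ∈ T := (Finset.mem_insert.1 hu).resolve_left hvu.ne'
      refine ⟨u, huT, hvu, fun a ha b hb hab => ?_, fun a ha hva => ?_⟩
      · rcases h a (Finset.mem_insert_of_mem ha) b (Finset.mem_insert_of_mem hb) hab with
          ⟨rfl, -⟩ | ⟨-, rfl⟩
        · exact hv ha
        · exact hv hb
      · rcases h v (Finset.mem_insert_self _ _) a (Finset.mem_insert_of_mem ha) hva with
          ⟨-, rfl⟩ | ⟨-, rfl⟩
        · rfl
        · exact absurd ha hv
    rcases Finset.mem_insert.1 hx with rfl | hxT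
    · exact .inr (key y hy hxy h)
    rcases Finset.mem_insert.1 hy with rfl | hyT
    · exact .inr (key x hx hxy.symm fun a ha b hb hab => (h a ha b hb hab).symm)
    · refine .inl ⟨⟨x, hxT, y, hyT, hxy, fun a ha b hb hab =>
        h a (Finset.mem_insert_of_mem ha) b (Finset.mem_insert_of_mem hb) hab⟩, fun a ha hva => ?_⟩
      rcases h v (Finset.mem_insert_self _ _) a (Finset.mem_insert_of_mem ha) hva with
        ⟨rfl, -⟩ | ⟨rfl, -⟩
      · exact hv hxT
      · exact hv hyT
  · rintro (⟨⟨x, hx, y, hy, hxy, h⟩, hn⟩ | ⟨u, hu, hvu, hT, h⟩)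
    · refine ⟨x, Finset.mem_insert_of_mem hx, y, Finset.mem_insert_of_mem hy, hxy, ?_⟩
      intro a ha b hb hab
      rcases Finset.mem_insert.1 ha with rfl | ha'
      · exact absurd hab (hn b ((Finset.mem_insert.1 hb).resolve_left hab.ne'))
      rcases Finset.mem_insert.1 hb with rfl | hb'
      · exact absurd hab.symm (hn a ha')
      · exact h a ha' b hb' hab
    · refine ⟨v, Finset.mem_insert_self _ _, u, Finset.mem_insert_of_mem hu, hvu, ?_⟩
      intro a ha b hb hab
      rcases Finset.mem_insert.1 ha with rfl | ha'
      · exact .inl ⟨rfl, h b ((Finset.mem_insert.1 hb).resolve_left hab.ne') hab⟩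
      rcases Finset.mem_insert.1 hb with rfl | hb'
      · exact .inr ⟨h a ha' hab.symm, rfl⟩
      · exact absurd hab (hT a ha' b hb')

lemma card_filter_powerset_insert_s16 {v : V} {U : Finset V} (hv : v ∉ U) (P : Finset V → Prop) :
    ((insert v U).powerset.filter P).card =
      (U.powerset.filter P).card + (U.powerset.filter fun T => P (insert v T)).card := by
  simp only [Finset.card_filter]
  exact Finset.sum_powerset_insert hv _

lemma indepCount_insert {v : V} {U : Finset V} (hv : v ∉ U) :
    indepCount G (insert v U) = indepCount G U + indepCount G (nonNbrs G v U) := by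
  rw [indepCount, card_filter_powerset_insert_s16 hv, indepCount, indepCount]
  congr 2
  ext T
  simp only [Finset.mem_filter, Finset.mem_powerset, edgeless_insert, Finset.subset_iff,
    mem_nonNbrs]
  grind

lemma oneEdgeCount_insert {v : V} {U : Finset V} (hv : v ∉ U) :
    oneEdgeCount G (insert v U) = oneEdgeCount G U + oneEdgeCount G (nonNbrs G v U) +
      ∑ u ∈ nbrs G v U, indepCount G (nonNbrs G u (nonNbrs G v U)) := by
  have hset : (U.powerset.filter fun T => SpansOneEdge G (insert v T)) =
      (nonNbrs G v U).powerset.filter (SpansOneEdge G) ∪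
        (nbrs G v U).biUnion fun u =>
          ((nonNbrs G u (nonNbrs G v U)).powerset.filter (Edgeless G)).image (insert u) := by
    ext T
    simp only [Finset.mem_filter, Finset.mem_powerset, Finset.mem_union, Finset.mem_biUnion,
      Finset.mem_image]
    constructor
    · rintro ⟨hTU, hT⟩
      rcases (spansOneEdge_insert G (fun h => hv (hTU h))).1 hT with ⟨h₁, h₂⟩ | ⟨u, hu, hvu, h₁, h₂⟩
      · exact .inl ⟨fun x hx => (mem_nonNbrs G).2 ⟨hTU hx, h₂ x hx⟩, h₁⟩
      · refine .inr ⟨u, (mem_nbrs G).2 ⟨hTU hu, hvu⟩, T.erase u, ⟨fun x hx => ?_, ?_⟩,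
          Finset.insert_erase hu⟩
        · obtain ⟨hxu, hxT⟩ := Finset.mem_erase.1 hx
          exact (mem_nonNbrs G).2 ⟨(mem_nonNbrs G).2 ⟨hTU hxT, fun h => hxu (h₂ x hxT h)⟩,
            h₁ u hu x hxT⟩
        · exact fun x hx y hy => h₁ x (Finset.mem_of_mem_erase hx) y (Finset.mem_of_mem_erase hy)
    · rintro (⟨hTU, hT⟩ | ⟨u, hu, T', ⟨hT'U, hT'⟩, rfl⟩)
      · have hT₀ : T ⊆ U := fun x hx => ((mem_nonNbrs G).1 (hTU hx)).1
        exact ⟨hT₀, (spansOneEdge_insert G (fun h => hv (hT₀ h))).2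
          (.inl ⟨hT, fun x hx => ((mem_nonNbrs G).1 (hTU hx)).2⟩)⟩
      · obtain ⟨huU, hvu⟩ := (mem_nbrs G).1 hu
        have hmem : ∀ x ∈ T', (x ∈ U ∧ ¬ G.Adj v x) ∧ ¬ G.Adj u x := fun x hx => by
          simpa only [mem_nonNbrs] using hT'U hx
        have hT₀ : insert u T' ⊆ U :=
          Finset.insert_subset huU fun x hx => (hmem x hx).1.1
        refine ⟨hT₀, (spansOneEdge_insert G (fun h => hv (hT₀ h))).2
          (.inr ⟨u, Finset.mem_insert_self _ _, hvu,
            (edgeless_insert G).2 ⟨hT', fun x hx => (hmem x hx).2⟩, fun x hx hvx => ?_⟩)⟩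
        exact (Finset.mem_insert.1 hx).resolve_right fun hx => (hmem x hx).1.2 hvx
  rw [oneEdgeCount, card_filter_powerset_insert_s16 hv, hset, Finset.card_union_of_disjoint,
    Finset.card_biUnion, ← add_assoc]
  · congr 1
    refine Finset.sum_congr rfl fun u hu => ?_
    refine Finset.card_image_of_injOn fun A hA B hB hAB => ?_
    have hnot : ∀ A ∈ ((nonNbrs G u (nonNbrs G v U)).powerset.filter (Edgeless G)), u ∉ A := by
      intro A hA huA
      have := (Finset.mem_powerset.1 (Finset.mem_filter.1 hA).1) huA
      simp only [mem_nonNbrs, mem_nbrs] at this hu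
      exact this.1.2 hu.2
    rw [← Finset.erase_insert (hnot A hA), ← Finset.erase_insert (hnot B hB)]
    exact congrArg (fun T => T.erase u) hAB
  · intro u hu w hw huw
    refine Finset.disjoint_left.2 fun T hT hT' => ?_
    simp only [Finset.mem_image, Finset.mem_filter, Finset.mem_powerset] at hT hT'
    obtain ⟨A, -, rfl⟩ := hT
    obtain ⟨B, ⟨hB, -⟩, hBA⟩ := hT'
    have huB : u ∈ insert w B := hBA ▸ Finset.mem_insert_self u A
    have := hB ((Finset.mem_insert.1 huB).resolve_left huw)
    simp only [Finset.mem_coe, mem_nonNbrs, mem_nbrs] at this hu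
    exact this.1.2 hu.2
  · refine Finset.disjoint_left.2 fun T hT hT' => ?_
    simp only [Finset.mem_biUnion, Finset.mem_image, Finset.mem_filter,
      Finset.mem_powerset] at hT hT'
    obtain ⟨u, hu, A, -, rfl⟩ := hT'
    exact ((mem_nonNbrs G).1 (hT.1 (Finset.mem_insert_self u A))).2 ((mem_nbrs G).1 hu).2

lemma indepCount_le_two_pow (U : Finset V) : indepCount G U ≤ 2 ^ U.card :=
  (Finset.card_filter_le _ _).trans_eq (Finset.card_powerset U)

lemma indepCount_mono {A B : Finset V} (h : A ⊆ B) : indepCount G A ≤ indepCount G B :=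
  Finset.card_le_card (Finset.filter_subset_filter _ (Finset.powerset_mono.2 h))

lemma indepCount_add_oneEdgeCount_le (U : Finset V) :
    indepCount G U + oneEdgeCount G U ≤ 2 ^ U.card := by
  rw [indepCount, oneEdgeCount, ← Finset.card_powerset, ← Finset.card_union_of_disjoint]
  · exact Finset.card_le_card
      (Finset.union_subset (Finset.filter_subset _ _) (Finset.filter_subset _ _))
  · refine Finset.disjoint_filter.2 ?_
    rintro T - hT ⟨x, hx, y, hy, hxy, -⟩
    exact hT x hx y hy hxy

lemma oneEdgeCount_eq_zero {U : Finset V} (h : Edgeless G U) : oneEdgeCount G U = 0 := by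
  rw [oneEdgeCount, Finset.card_eq_zero, Finset.filter_eq_empty_iff]
  rintro T hT ⟨x, hx, y, hy, hxy, -⟩
  exact h x (Finset.mem_powerset.1 hT hx) y (Finset.mem_powerset.1 hT hy) hxy

lemma indepCount_eq_two_pow {U : Finset V} (h : Edgeless G U) : indepCount G U = 2 ^ U.card := by
  rw [indepCount, Finset.filter_true_of_mem, Finset.card_powerset]
  intro T hT x hx y hy
  exact h x (Finset.mem_powerset.1 hT hx) y (Finset.mem_powerset.1 hT hy)

lemma two_mul_indepCount_nonNbrs_le {v : V} {U : Finset V} (h : (nbrs G v U).Nonempty) :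
    2 * indepCount G (nonNbrs G v U) ≤ 2 ^ U.card := by
  have h₁ := card_nbrs_add_card_nonNbrs G v U
  have h₂ := h.card_pos
  calc 2 * indepCount G (nonNbrs G v U) ≤ 2 ^ ((nonNbrs G v U).card + 1) := by
        rw [pow_succ']; exact Nat.mul_le_mul_left _ (indepCount_le_two_pow G _)
    _ ≤ 2 ^ U.card := Nat.pow_le_pow_right two_pos (by omega)

lemma exists_nbr_of_not_edgeless {U : Finset V} (h : ¬ Edgeless G U) :
    ∃ v W, v ∉ W ∧ U = insert v W ∧ (nbrs G v W).Nonempty := by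
  simp only [Edgeless, not_forall, not_not] at h
  obtain ⟨x, hx, y, hy, hxy⟩ := h
  exact ⟨x, U.erase x, Finset.notMem_erase _ _, (Finset.insert_erase hx).symm,
    y, (mem_nbrs G).2 ⟨Finset.mem_erase.2 ⟨hxy.ne', hy⟩, hxy⟩⟩

lemma four_mul_indepCount_le {U : Finset V} (h : ¬ Edgeless G U) :
    4 * indepCount G U ≤ 3 * 2 ^ U.card := by
  obtain ⟨v, W, hv, rfl, hn⟩ := exists_nbr_of_not_edgeless G h
  rw [indepCount_insert G hv, Finset.card_insert_of_notMem hv, pow_succ]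
  have h₁ := two_mul_indepCount_nonNbrs_le G hn
  have h₂ := indepCount_le_two_pow G W
  omega

lemma nonNbrs_eq_self {v : V} {U : Finset V} (h : nbrs G v U = ∅) : nonNbrs G v U = U := by
  rw [nbrs, Finset.filter_eq_empty_iff] at h
  exact Finset.filter_true_of_mem fun x hx => h hx

lemma nbrs_union_nonNbrs (v : V) (U : Finset V) : nbrs G v U ∪ nonNbrs G v U = U :=
  Finset.filter_union_filter_not_eq _ _

lemma sum_indepCount_le (v : V) (U : Finset V) :
    ∑ u ∈ nbrs G v U, indepCount G (nonNbrs G u (nonNbrs G v U)) ≤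
      (nbrs G v U).card * indepCount G (nonNbrs G v U) := by
  rw [← smul_eq_mul]
  exact Finset.sum_le_card_nsmul _ _ _ fun u _ => indepCount_mono G (Finset.filter_subset _ _)

lemma counts_insert_insert_of_adj {v w : V} {H : Finset V} (hv : v ∉ H) (hw : w ∉ H)
    (hvw : G.Adj v w) (hvH : nbrs G v H = ∅) (hwH : nbrs G w H = ∅) :
    indepCount G (insert v (insert w H)) = 3 * indepCount G H ∧
      oneEdgeCount G (insert v (insert w H)) = 3 * oneEdgeCount G H + indepCount G H := by
  have hv' : v ∉ insert w H := by simp [hvw.ne, hv]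
  have h₁ : nbrs G v (insert w H) = {w} := by
    rw [nbrs, Finset.filter_insert, if_pos hvw]
    exact congrArg (insert w) hvH
  have h₂ : nonNbrs G v (insert w H) = H := by
    rw [nonNbrs, Finset.filter_insert, if_neg (not_not.2 hvw)]
    exact nonNbrs_eq_self G hvH
  rw [indepCount_insert G hv', oneEdgeCount_insert G hv', h₁, h₂, indepCount_insert G hw,
    oneEdgeCount_insert G hw, hwH, nonNbrs_eq_self G hwH]
  simp only [Finset.sum_singleton, Finset.sum_empty, nonNbrs_eq_self G hwH]
  constructor <;> ring

lemma counts_insert_of_isolated {v : V} {H : Finset V} (hv : v ∉ H) (hvH : nbrs G v H = ∅) :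
    indepCount G (insert v H) = 2 * indepCount G H ∧
      oneEdgeCount G (insert v H) = 2 * oneEdgeCount G H := by
  rw [indepCount_insert G hv, oneEdgeCount_insert G hv, hvH, nonNbrs_eq_self G hvH]
  simp only [Finset.sum_empty]
  constructor <;> ring

lemma eight_mul_indepCount_add_le (U : Finset V) :
    8 * indepCount G U + 12 * oneEdgeCount G U ≤ 9 * 2 ^ U.card := by
  induction U using Finset.strongInduction with
  | H U ih =>
  by_cases hU : Edgeless G U
  · have := oneEdgeCount_eq_zero G hU
    have := indepCount_le_two_pow G U
    omega
  obtain ⟨v, W, hv, rfl, hn⟩ := exists_nbr_of_not_edgeless G hU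
  have hWU : W ⊂ insert v W := Finset.ssubset_insert hv
  have hHU : nonNbrs G v W ⊂ insert v W := (Finset.filter_subset _ _).trans_ssubset hWU
  have ihW := ih W hWU
  have ihH := ih _ hHU
  have hI := indepCount_insert G hv
  have hS := oneEdgeCount_insert G hv
  have hc := card_nbrs_add_card_nonNbrs G v W
  have hsum := sum_indepCount_le G v W
  have hIH := indepCount_le_two_pow G (nonNbrs G v W)
  have hIS := indepCount_add_oneEdgeCount_le G (nonNbrs G v W)
  have hpos := hn.card_pos
  rw [Finset.card_insert_of_notMem hv, pow_succ]
  rcases Nat.lt_or_ge 1 (nbrs G v W).card with hd | hd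
  · have hsum' := hsum.trans (Nat.mul_le_mul_left _ hIH)
    have hW : 2 ^ W.card = 2 ^ (nbrs G v W).card * 2 ^ (nonNbrs G v W).card := by
      rw [← pow_add, hc]
    have hd' : 9 + 12 * (nbrs G v W).card ≤ 9 * 2 ^ (nbrs G v W).card := by
      generalize (nbrs G v W).card = d at hd
      induction d, hd using Nat.le_induction with
      | base => norm_num
      | succ d hd ihd => rw [pow_succ]; omega
    have := Nat.mul_le_mul_right (2 ^ (nonNbrs G v W).card) hd'
    rw [hI, hS]
    nlinarith
  · obtain ⟨u, hu⟩ := Finset.card_eq_one.1 (le_antisymm hd hpos)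
    have hW : W = insert u (nonNbrs G v W) := by
      conv_lhs => rw [← nbrs_union_nonNbrs G v W, hu]
      rfl
    have hW2 : 2 ^ W.card = 2 * 2 ^ (nonNbrs G v W).card := by
      rw [← hc, hu, Finset.card_singleton, pow_add, pow_one]
    have huv : u ∈ W ∧ G.Adj v u := (mem_nbrs G).1 (hu ▸ Finset.mem_singleton_self u)
    rw [hu, Finset.sum_singleton] at hS
    rcases (nbrs G u (nonNbrs G v W)).eq_empty_or_nonempty with he | hne
    · have := counts_insert_insert_of_adj G (H := nonNbrs G v W) (v := v) (w := u)
        (fun h => hv ((mem_nonNbrs G).1 h).1) (fun h => ((mem_nonNbrs G).1 h).2 huv.2) huv.2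
        (by ext x; simp [mem_nbrs, mem_nonNbrs]) he
      rw [← hW] at this
      omega
    · have := two_mul_indepCount_nonNbrs_le G hne
      omega

lemma oneEdgeCount_insert_lt {v : V} {W : Finset V} (hv : v ∉ W)
    (hd : 2 ≤ (nbrs G v W).card) (ihW : 64 * oneEdgeCount G W ≤ 27 * 2 ^ W.card)
    (ihH : 64 * oneEdgeCount G (nonNbrs G v W) ≤ 27 * 2 ^ (nonNbrs G v W).card) :
    64 * oneEdgeCount G (insert v W) < 27 * 2 ^ (insert v W).card := by
  have hS := oneEdgeCount_insert G hv
  have hc := card_nbrs_add_card_nonNbrs G v W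
  have hsum := sum_indepCount_le G v W
  have hIH := indepCount_le_two_pow G (nonNbrs G v W)
  have hW2 : 2 ^ W.card = 2 ^ (nbrs G v W).card * 2 ^ (nonNbrs G v W).card := by
    rw [← pow_add, hc]
  have hpos : 0 < 2 ^ (nonNbrs G v W).card := by positivity
  rw [Finset.card_insert_of_notMem hv, pow_succ]
  have hedge : oneEdgeCount G (nonNbrs G v W) = 0 ∨
      4 * indepCount G (nonNbrs G v W) ≤ 3 * 2 ^ (nonNbrs G v W).card :=
    (em (Edgeless G (nonNbrs G v W))).imp (oneEdgeCount_eq_zero G) (four_mul_indepCount_le G)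
  rcases Nat.lt_or_ge 3 (nbrs G v W).card with hd4 | hd3
  · have hsum' := hsum.trans (Nat.mul_le_mul_left _ hIH)
    have hd' : 27 + 64 * (nbrs G v W).card < 27 * 2 ^ (nbrs G v W).card := by
      generalize (nbrs G v W).card = d at hd4
      induction d, hd4 using Nat.le_induction with
      | base => norm_num
      | succ d hd ihd => rw [pow_succ]; omega
    have := Nat.mul_lt_mul_of_pos_right hd' hpos
    rw [hS]
    nlinarith
  obtain hd3 | hd2 : (nbrs G v W).card = 3 ∨ (nbrs G v W).card = 2 := by omega
  · rw [hd3] at hsum hW2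
    omega
  obtain ⟨u, w, huw, hN⟩ := Finset.card_eq_two.1 hd2
  rw [hd2] at hW2
  rw [hN, Finset.sum_pair huw] at hS
  have hW : W = insert u (insert w (nonNbrs G v W)) := by
    conv_lhs => rw [← nbrs_union_nonNbrs G v W, hN]
    rw [Finset.insert_union]
    rfl
  have hvu : G.Adj v u := ((mem_nbrs G).1 (hN ▸ by simp : u ∈ nbrs G v W)).2
  have hvw : G.Adj v w := ((mem_nbrs G).1 (hN ▸ by simp : w ∈ nbrs G v W)).2
  have huH : u ∉ nonNbrs G v W := fun h => ((mem_nonNbrs G).1 h).2 hvu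
  have hwH : w ∉ nonNbrs G v W := fun h => ((mem_nonNbrs G).1 h).2 hvw
  have hg := eight_mul_indepCount_add_le G (nonNbrs G v W)
  rcases (nbrs G u (nonNbrs G v W)).eq_empty_or_nonempty with hu | hu <;>
  rcases (nbrs G w (nonNbrs G v W)).eq_empty_or_nonempty with hw | hw
  · rw [nonNbrs_eq_self G hu, nonNbrs_eq_self G hw] at hS
    by_cases hadj : G.Adj u w
    · have := (counts_insert_insert_of_adj G huH hwH hadj hu hw).2
      rw [← hW] at this
      omega
    · have h₁ := (counts_insert_of_isolated G hwH hw).2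
      have h₂ := (counts_insert_of_isolated G (v := u) (H := insert w (nonNbrs G v W))
        (by simp [huw, huH]) (by rw [nbrs, Finset.filter_insert, if_neg hadj]; exact hu)).2
      rw [← hW] at h₂
      omega
  · have := two_mul_indepCount_nonNbrs_le G hw
    rw [nonNbrs_eq_self G hu] at hS
    omega
  · have := two_mul_indepCount_nonNbrs_le G hu
    rw [nonNbrs_eq_self G hw] at hS
    omega
  · have := two_mul_indepCount_nonNbrs_le G hu
    have := two_mul_indepCount_nonNbrs_le G hw
    omega

/-- `f 0, …, f (2m + b - 1)` are distinct and the edges among them are the pairs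
`f (2k), f (2k + 1)` with `k < m`. -/
def IsMatchingEnum (f : ℕ → V) (m b : ℕ) : Prop :=
  Set.InjOn f (Set.Iio (2 * m + b)) ∧
    ∀ i < 2 * m + b, ∀ j < 2 * m + b, G.Adj (f i) (f j) ↔
      (i % 2 = 0 ∧ i + 1 = j ∧ j < 2 * m) ∨ (j % 2 = 0 ∧ j + 1 = i ∧ i < 2 * m)

lemma image_range_add_two (f : ℕ → V) (k : ℕ) :
    (Finset.range (k + 2)).image f =
      insert (f 0) (insert (f 1) ((Finset.range k).image fun i => f (i + 2))) := by
  ext x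
  simp only [Finset.mem_image, Finset.mem_range, Finset.mem_insert]
  constructor
  · rintro ⟨_ | _ | i, hi, rfl⟩
    · exact .inl rfl
    · exact .inr (.inl rfl)
    · exact .inr (.inr ⟨i, by omega, rfl⟩)
  · rintro (rfl | rfl | ⟨i, hi, rfl⟩)
    · exact ⟨0, by omega, rfl⟩
    · exact ⟨1, by omega, rfl⟩
    · exact ⟨i + 2, by omega, rfl⟩

variable {G} in
lemma IsMatchingEnum.counts {f : ℕ → V} {m b : ℕ} (h : IsMatchingEnum G f m b) :
    4 ^ m * indepCount G ((Finset.range (2 * m + b)).image f) = 3 ^ m * 2 ^ (2 * m + b) ∧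
      3 * 4 ^ m * oneEdgeCount G ((Finset.range (2 * m + b)).image f) =
        m * 3 ^ m * 2 ^ (2 * m + b) := by
  induction m generalizing f with
  | zero =>
    obtain ⟨hinj, hadj⟩ := h
    have he : Edgeless G ((Finset.range (2 * 0 + b)).image f) := by
      intro x hx y hy
      obtain ⟨i, hi, rfl⟩ := Finset.mem_image.1 hx
      obtain ⟨j, hj, rfl⟩ := Finset.mem_image.1 hy
      rw [hadj i (Finset.mem_range.1 hi) j (Finset.mem_range.1 hj)]
      omega
    have hcard : ((Finset.range (2 * 0 + b)).image f).card = 2 * 0 + b := by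
      rw [Finset.card_image_of_injOn (by simpa using hinj), Finset.card_range]
    rw [oneEdgeCount_eq_zero G he, indepCount_eq_two_pow G he, hcard]
    simp
  | succ m ih =>
    obtain ⟨hinj, hadj⟩ := h
    have hne : ∀ {i j}, i < 2 * (m + 1) + b → j < 2 * (m + 1) + b → i ≠ j → f i ≠ f j :=
      fun hi hj hij h => hij (hinj hi hj h)
    obtain ⟨ihI, ihS⟩ := ih (f := fun i => f (i + 2)) ⟨fun i hi j hj hij => by
        simp only [Set.mem_Iio] at hi hj
        have := hinj (show i + 2 < _ by omega) (show j + 2 < _ by omega) hij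
        omega, fun i hi j hj => by
        rw [hadj (i + 2) (by omega) (j + 2) (by omega)]
        omega⟩
    have h01 : G.Adj (f 0) (f 1) := (hadj 0 (by omega) 1 (by omega)).2 (by omega)
    have hcounts := counts_insert_insert_of_adj G (v := f 0) (w := f 1)
      (H := (Finset.range (2 * m + b)).image fun i => f (i + 2))
      (by
        simp only [Finset.mem_image, Finset.mem_range, not_exists, not_and]
        exact fun i hi => hne (by omega) (by omega) (by omega))
      (by
        simp only [Finset.mem_image, Finset.mem_range, not_exists, not_and]
        exact fun i hi => hne (by omega) (by omega) (by omega))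
      h01
      (by
        simp only [nbrs, Finset.filter_eq_empty_iff, Finset.mem_image, Finset.mem_range]
        rintro _ ⟨i, hi, rfl⟩
        rw [hadj 0 (by omega) (i + 2) (by omega)]
        omega)
      (by
        simp only [nbrs, Finset.filter_eq_empty_iff, Finset.mem_image, Finset.mem_range]
        rintro _ ⟨i, hi, rfl⟩
        rw [hadj 1 (by omega) (i + 2) (by omega)]
        omega)
    rw [← image_range_add_two, show 2 * m + b + 2 = 2 * (m + 1) + b by ring] at hcounts
    rw [hcounts.1, hcounts.2, show 2 * (m + 1) + b = 2 * m + b + 2 by ring]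
    simp only [pow_succ] at *
    constructor
    · linear_combination 12 * ihI
    · linear_combination 12 * ihS + 12 * ihI

lemma exists_isMatchingEnum [Nonempty V] (U : Finset V)
    (hU : ∀ v ∈ U, (nbrs G v U).card ≤ 1) :
    ∃ f m b, IsMatchingEnum G f m b ∧ (Finset.range (2 * m + b)).image f = U := by
  induction U using Finset.strongInduction with
  | H U ih =>
  by_cases he : Edgeless G U
  · let f : ℕ → V := fun i => if h : i < U.card then U.equivFin.symm ⟨i, h⟩ else Classical.arbitrary V
    have hf : ∀ i (h : i < U.card), f i = U.equivFin.symm ⟨i, h⟩ := fun i h => dif_pos h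
    have hmem : ∀ i < U.card, f i ∈ U := fun i h => by rw [hf i h]; exact Subtype.property _
    refine ⟨f, 0, U.card, ⟨fun i hi j hj hij => ?_, fun i hi j hj => ?_⟩, ?_⟩
    · simp only [Set.mem_Iio, mul_zero, zero_add] at hi hj
      rw [hf i hi, hf j hj] at hij
      simpa using U.equivFin.symm.injective (Subtype.ext hij)
    · exact iff_of_false (he _ (hmem i (by omega)) _ (hmem j (by omega))) (by omega)
    · ext x
      simp only [Finset.mem_image, Finset.mem_range, mul_zero, zero_add]
      constructor
      · rintro ⟨i, hi, rfl⟩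
        exact hmem i hi
      · intro hx
        exact ⟨U.equivFin ⟨x, hx⟩, Fin.is_lt _, by rw [hf _ (Fin.is_lt _)]; simp⟩
  · obtain ⟨v, W, hv, rfl, w, hw⟩ := exists_nbr_of_not_edgeless G he
    obtain ⟨hwW, hvw⟩ := (mem_nbrs G).1 hw
    have huniq : ∀ a ∈ insert v W, ∀ x ∈ insert v W, ∀ y ∈ insert v W,
        G.Adj a x → G.Adj a y → x = y := fun a ha x hx y hy hax hay =>
      Finset.card_le_one.1 (hU a ha) x ((mem_nbrs G).2 ⟨hx, hax⟩) y ((mem_nbrs G).2 ⟨hy, hay⟩)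
    have hsub : W.erase w ⊂ insert v W :=
      (Finset.erase_subset _ _).trans_ssubset (Finset.ssubset_insert hv)
    obtain ⟨g, m, b, ⟨hinj, hadj⟩, himg⟩ := ih (W.erase w) hsub fun a ha =>
      (Finset.card_le_card (Finset.filter_subset_filter _ hsub.subset)).trans
        (hU a (hsub.subset ha))
    have hg : ∀ i < 2 * m + b, g i ∈ W ∧ g i ≠ w ∧ g i ≠ v := fun i hi => by
      have : g i ∈ W.erase w := himg ▸ Finset.mem_image_of_mem g (Finset.mem_range.2 hi)
      rw [Finset.mem_erase] at this
      exact ⟨this.2, this.1, fun h => hv (h ▸ this.2)⟩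
    have hvg : ∀ i < 2 * m + b, ¬ G.Adj v (g i) := fun i hi h =>
      (hg i hi).2.1 (huniq v (by simp) _ (by simp [(hg i hi).1]) w (by simp [hwW]) h hvw)
    have hwg : ∀ i < 2 * m + b, ¬ G.Adj w (g i) := fun i hi h =>
      (hg i hi).2.2 (huniq w (by simp [hwW]) _ (by simp [(hg i hi).1]) v (by simp) h hvw.symm)
    let f : ℕ → V := fun
      | 0 => v
      | 1 => w
      | i + 2 => g i
    refine ⟨f, m + 1, b, ⟨?_, ?_⟩, ?_⟩
    · rintro (_ | _ | i) hi (_ | _ | j) hj hij <;> simp only [Set.mem_Iio] at hi hj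
      · rfl
      · exact absurd hij hvw.ne
      · exact absurd hij.symm (hg j (by omega)).2.2
      · exact absurd hij hvw.ne'
      · rfl
      · exact absurd hij.symm (hg j (by omega)).2.1
      · exact absurd hij (hg i (by omega)).2.2
      · exact absurd hij (hg i (by omega)).2.1
      · have := hinj (show i < _ by omega) (show j < _ by omega) hij
        omega
    · rintro (_ | _ | i) hi (_ | _ | j) hj
      · exact iff_of_false (G.loopless.irrefl v) (by omega)
      · exact iff_of_true hvw (by omega)
      · exact iff_of_false (hvg j (by omega)) (by omega)
      · exact iff_of_true hvw.symm (by omega)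
      · exact iff_of_false (G.loopless.irrefl w) (by omega)
      · exact iff_of_false (hwg j (by omega)) (by omega)
      · exact iff_of_false (fun h => hvg i (by omega) h.symm) (by omega)
      · exact iff_of_false (fun h => hwg i (by omega) h.symm) (by omega)
      · refine (hadj i (by omega) j (by omega)).trans ?_
        omega
    · rw [show 2 * (m + 1) + b = 2 * m + b + 2 by ring, image_range_add_two]
      change insert v (insert w ((Finset.range (2 * m + b)).image g)) = _
      rw [himg, Finset.insert_erase hwW]

lemma mul_three_pow_le (m : ℕ) :
    64 * (m * 3 ^ m) ≤ 81 * 4 ^ m ∧ (64 * (m * 3 ^ m) = 81 * 4 ^ m → m = 3 ∨ m = 4) := by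
  rcases Nat.lt_or_ge m 5 with hm | hm
  · interval_cases m <;> norm_num
  · have : 64 * (m * 3 ^ m) < 81 * 4 ^ m := by
      induction m, hm using Nat.le_induction with
      | base => norm_num
      | succ m hm ih => rw [pow_succ, pow_succ]; nlinarith [pow_pos (three_pos (α := ℕ)) m]
    exact ⟨this.le, fun h => absurd h this.ne⟩

variable {G} in
lemma IsMatchingEnum.card_image {f : ℕ → V} {m b : ℕ} (h : IsMatchingEnum G f m b) :
    ((Finset.range (2 * m + b)).image f).card = 2 * m + b := by
  rw [Finset.card_image_of_injOn (by simpa using h.1), Finset.card_range]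

variable {G} in
lemma IsMatchingEnum.oneEdgeCount_eq_iff {f : ℕ → V} {m b : ℕ} (h : IsMatchingEnum G f m b) :
    64 * oneEdgeCount G ((Finset.range (2 * m + b)).image f) = 27 * 2 ^ (2 * m + b) ↔
      64 * (m * 3 ^ m) = 81 * 4 ^ m := by
  have hS := h.counts.2
  have h4 : 0 < 3 * 4 ^ m := by positivity
  have h2 : 0 < 2 ^ (2 * m + b) := by positivity
  rw [← Nat.mul_right_inj h4.ne', ← Nat.mul_left_inj h2.ne' (b := 64 * (m * 3 ^ m))]
  constructor <;> intro h <;> linarith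

lemma nbrs_erase_self (v : V) (U : Finset V) : nbrs G v (U.erase v) = nbrs G v U := by
  ext x
  simp only [mem_nbrs, Finset.mem_erase]
  exact ⟨fun h => ⟨h.1.2, h.2⟩, fun h => ⟨⟨h.2.ne', h.1⟩, h.2⟩⟩

lemma oneEdgeCount_le (U : Finset V) : 64 * oneEdgeCount G U ≤ 27 * 2 ^ U.card := by
  induction U using Finset.strongInduction with
  | H U ih =>
  by_cases hU : ∀ v ∈ U, (nbrs G v U).card ≤ 1
  · rcases U.eq_empty_or_nonempty with rfl | ⟨x, -⟩
    · rw [oneEdgeCount_eq_zero G (by simp [Edgeless])]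
      omega
    have : Nonempty V := ⟨x⟩
    obtain ⟨f, m, b, hf, rfl⟩ := exists_isMatchingEnum G U hU
    have h4 : 0 < 3 * 4 ^ m := by positivity
    rw [hf.card_image]
    refine Nat.le_of_mul_le_mul_left ?_ h4
    have := Nat.mul_le_mul_right (2 ^ (2 * m + b)) (mul_three_pow_le m).1
    linarith [hf.counts.2]
  · push Not at hU
    obtain ⟨v, hv, hd⟩ := hU
    have hn : v ∉ U.erase v := Finset.notMem_erase v U
    have hss := Finset.erase_ssubset hv
    have := oneEdgeCount_insert_lt G hn (by rwa [nbrs_erase_self]) (ih _ hss)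
      (ih _ ((Finset.filter_subset _ _).trans_ssubset hss))
    rw [Finset.insert_erase hv] at this
    exact this.le

lemma card_nbrs_le_one_of_eq {U : Finset V} (h : 64 * oneEdgeCount G U = 27 * 2 ^ U.card) :
    ∀ v ∈ U, (nbrs G v U).card ≤ 1 := by
  by_contra! hU
  obtain ⟨v, hv, hd⟩ := hU
  have := oneEdgeCount_insert_lt G (Finset.notMem_erase v U) (by rwa [nbrs_erase_self])
    (oneEdgeCount_le G _) (oneEdgeCount_le G _)
  rw [Finset.insert_erase hv] at this
  exact this.ne h

lemma exists_isMatchingEnum_iff [Fintype V] [Nonempty V] (m b : ℕ) :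
    (∃ f, IsMatchingEnum G f m b ∧ (Finset.range (2 * m + b)).image f = Finset.univ) ↔
      Nonempty (G ≃g matchingUnion m b) := by
  constructor
  · rintro ⟨f, ⟨hinj, hadj⟩, himg⟩
    have hbij : Function.Bijective fun i : Fin (2 * m + b) => f i := by
      refine ⟨fun i j hij => Fin.ext (hinj i.is_lt j.is_lt hij), fun x => ?_⟩
      obtain ⟨i, hi, rfl⟩ := Finset.mem_image.1 (himg ▸ Finset.mem_univ x)
      exact ⟨⟨i, Finset.mem_range.1 hi⟩, rfl⟩
    refine ⟨RelIso.symm ⟨Equiv.ofBijective _ hbij, fun {i j} => ?_⟩⟩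
    refine (hadj i i.is_lt j j.is_lt).trans ?_
    simp only [matchingUnion, SimpleGraph.fromRel_adj, ne_eq, Fin.ext_iff]
    omega
  · rintro ⟨φ⟩
    let f : ℕ → V := fun i =>
      if h : i < 2 * m + b then φ.symm ⟨i, h⟩ else Classical.arbitrary V
    have hf : ∀ i (h : i < 2 * m + b), f i = φ.symm ⟨i, h⟩ := fun i h => dif_pos h
    refine ⟨f, ⟨fun i hi j hj hij => ?_, fun i hi j hj => ?_⟩, ?_⟩
    · rw [hf i hi, hf j hj] at hij
      exact congrArg Fin.val (φ.symm.injective hij)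
    · rw [hf i hi, hf j hj, φ.symm.map_adj_iff]
      simp only [matchingUnion, SimpleGraph.fromRel_adj, ne_eq, Fin.ext_iff]
      omega
    · refine Finset.eq_univ_of_forall fun x => Finset.mem_image.2 ⟨φ x, ?_, ?_⟩
      · exact Finset.mem_range.2 (Fin.is_lt _)
      · rw [hf _ (Fin.is_lt _)]
        simp

lemma edgesWithin_ncard_eq_one_iff_s16 (T : Finset V) :
    (edgesWithin G T).ncard = 1 ↔ SpansOneEdge G T := by
  rw [Set.ncard_eq_one]
  constructor
  · rintro ⟨e, he⟩
    have hmem : e ∈ edgesWithin G T := he ▸ Set.mem_singleton e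
    induction e with
    | h x y =>
    refine ⟨x, hmem.2 x (by simp), y, hmem.2 y (by simp), hmem.1, fun a ha b hb hab => ?_⟩
    have : s(a, b) ∈ edgesWithin G T := ⟨hab, by simpa using ⟨ha, hb⟩⟩
    rw [he] at this
    simpa using this
  · rintro ⟨x, hx, y, hy, hxy, h⟩
    refine ⟨s(x, y), Set.eq_singleton_iff_unique_mem.2 ⟨⟨hxy, by simpa using ⟨hx, hy⟩⟩, ?_⟩⟩
    intro e he
    induction e with
    | h a b => simpa using h a (he.2 a (by simp)) b (he.2 b (by simp)) he.1

lemma sigma1_eq_oneEdgeCount [Fintype V] : sigma1 G = oneEdgeCount G Finset.univ := by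
  rw [sigma1, oneEdgeCount, Finset.powerset_univ, ← Fintype.card_subtype, ← Nat.card_eq_fintype_card]
  exact (Nat.card_congr (Fintype.finsetEquivSet.subtypeEquiv fun T =>
    (edgesWithin_ncard_eq_one_iff_s16 G T).symm)).symm

end Counting

/-- If `G` is a finite simple graph of order `n ≥ 6`, then `σ₁(G) ≤ (27/64)·2ⁿ`, with
equality if and only if `G ≅ 3K₂ ∪ (n−6)K₁` or `G ≅ 4K₂ ∪ (n−8)K₁` (the latter only
possible when `n ≥ 8`). -/
theorem sigma1_le_max {V : Type*} [Fintype V] (G : SimpleGraph V)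
    (hn : 6 ≤ Fintype.card V) :
    (sigma1 G : ℝ) ≤ 27 / 64 * 2 ^ Fintype.card V ∧
      ((sigma1 G : ℝ) = 27 / 64 * 2 ^ Fintype.card V ↔
        Nonempty (G ≃g matchingUnion 3 (Fintype.card V - 6)) ∨
        (8 ≤ Fintype.card V ∧ Nonempty (G ≃g matchingUnion 4 (Fintype.card V - 8)))) := by
  have : Nonempty V := Fintype.card_pos_iff.1 (by omega)
  rw [sigma1_eq_oneEdgeCount]
  constructor
  · have := oneEdgeCount_le G Finset.univ
    rw [Finset.card_univ] at this
    have : (64 * oneEdgeCount G Finset.univ : ℝ) ≤ 27 * 2 ^ Fintype.card V := by exact_mod_cast this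
    linarith
  have hcast : (oneEdgeCount G Finset.univ : ℝ) = 27 / 64 * 2 ^ Fintype.card V ↔
      64 * oneEdgeCount G Finset.univ = 27 * 2 ^ Fintype.card V := by
    rw [← @Nat.cast_inj ℝ]
    push_cast
    constructor <;> intro h <;> linarith
  rw [hcast]
  have hvalue : ∀ m b, 64 * (m * 3 ^ m) = 81 * 4 ^ m → Nonempty (G ≃g matchingUnion m b) →
      64 * oneEdgeCount G Finset.univ = 27 * 2 ^ Fintype.card V := by
    intro m b hm hiso
    obtain ⟨f, hf, himg⟩ := (exists_isMatchingEnum_iff G m b).2 hiso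
    have hcard := hf.card_image
    rw [himg, Finset.card_univ] at hcard
    rw [hcard, ← himg]
    exact hf.oneEdgeCount_eq_iff.2 hm
  constructor
  · intro h
    obtain ⟨f, m, b, hf, himg⟩ := exists_isMatchingEnum G Finset.univ
      (card_nbrs_le_one_of_eq G (by rwa [Finset.card_univ]))
    have hcard := hf.card_image
    rw [himg, Finset.card_univ] at hcard
    rw [hcard, ← himg, hf.oneEdgeCount_eq_iff] at h
    have hiso := (exists_isMatchingEnum_iff G m b).1 ⟨f, hf, himg⟩
    rw [hcard]
    rcases (mul_three_pow_le m).2 h with rfl | rfl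
    · left
      rwa [show 2 * 3 + b - 6 = b by omega]
    · right
      exact ⟨by omega, by rwa [show 2 * 4 + b - 8 = b by omega]⟩
  · rintro (h | ⟨-, h⟩)
    · exact hvalue _ _ (by norm_num) h
    · exact hvalue _ _ (by norm_num) h
end

section
/- Let n be an even positive integer and let G be the perfect matching (n/2)K₂, the disjoint union of n/2 copies of K₂. Then σ₁(G) = (n/2)·3^{n/2 − 1}; moreover, for all even n ≥ 10, σ₁(G) < (27/64)·2ⁿ. -/
open scoped Classical in
/-- The number of functions `ι → α` taking the value `a` exactly once. -/
theorem card_pi_eq_exactly_once {ι α : Type*} [Fintype ι] [Fintype α] (a : α) :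
    Nat.card {f : ι → α | {i | f i = a}.ncard = 1} =
      Fintype.card ι * (Fintype.card α - 1) ^ (Fintype.card ι - 1) := by
  let F : ι → Finset (ι → α) := fun i =>
    Fintype.piFinset fun j => if j = i then {a} else Finset.univ.erase a
  have mem_F (i : ι) (f : ι → α) : f ∈ F i ↔ {j | f j = a} = {i} := by
    simp only [F, Fintype.mem_piFinset, Set.ext_iff, Set.mem_ofPred_eq, Set.mem_singleton_iff]
    refine forall_congr' fun j => ?_
    split_ifs with h <;> simp [h]
  have hset : {f : ι → α | {i | f i = a}.ncard = 1} = (Finset.univ.biUnion F : Finset _) := by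
    ext f
    simp [mem_F, Set.ncard_eq_one]
  have hcard (i : ι) : (F i).card = (Fintype.card α - 1) ^ (Fintype.card ι - 1) := by
    rw [Fintype.card_piFinset, ← Finset.mul_prod_erase _ _ (Finset.mem_univ i),
      Finset.prod_congr rfl (g := fun _ => Fintype.card α - 1)]
    · simp
    · intro j hj
      simp [Finset.ne_of_mem_erase hj]
  rw [hset, Nat.card_coe_set_eq, Set.ncard_coe_finset, Finset.card_biUnion]
  · simp [hcard]
  · intro i _ j _ hij
    refine Finset.disjoint_left.2 fun f hi hj => hij ?_
    rw [mem_F] at hi hj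
    exact Set.singleton_injective (hi.symm.trans hj)

/-- The vertices of `matchingUnion m 0` as pairs (edge, endpoint). -/
def matchingVertexEquiv (m : ℕ) : Fin m × Fin 2 ≃ Fin (2 * m + 0) :=
  finProdFinEquiv.trans (finCongr (by ring))

theorem matchingVertexEquiv_val (m : ℕ) (i : Fin m) (b : Fin 2) :
    (matchingVertexEquiv m (i, b)).val = b.val + 2 * i.val := by
  simp [matchingVertexEquiv, finProdFinEquiv]

/-- A set of vertices of `matchingUnion m 0`, recorded by its trace on each edge. -/
def matchingTraceEquiv (m : ℕ) : Set (Fin (2 * m + 0)) ≃ (Fin m → Set (Fin 2)) where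
  toFun S i := {b | matchingVertexEquiv m (i, b) ∈ S}
  invFun f := {v | ((matchingVertexEquiv m).symm v).2 ∈ f ((matchingVertexEquiv m).symm v).1}
  left_inv S := by ext v; simp
  right_inv f := by ext i b; simp

theorem edgesWithin_matchingUnion (m : ℕ) (S : Set (Fin (2 * m + 0))) :
    edgesWithin (matchingUnion m 0) S =
      (fun i => s(matchingVertexEquiv m (i, 0), matchingVertexEquiv m (i, 1))) ''
        {i | matchingTraceEquiv m S i = Set.univ} := by
  have key (x y : Fin (2 * m + 0)) (h : x.val % 2 = 0 ∧ x.val + 1 = y.val ∧ y.val < 2 * m) :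
      ∃ i, matchingVertexEquiv m (i, 0) = x ∧ matchingVertexEquiv m (i, 1) = y := by
    refine ⟨⟨x.val / 2, by omega⟩, ?_, ?_⟩ <;>
    · rw [Fin.ext_iff, matchingVertexEquiv_val]
      simp
      omega
  have trace (i : Fin m) : matchingTraceEquiv m S i = Set.univ ↔
      matchingVertexEquiv m (i, 0) ∈ S ∧ matchingVertexEquiv m (i, 1) ∈ S := by
    simp [matchingTraceEquiv, Set.eq_univ_iff_forall, Fin.forall_fin_two]
  ext e
  induction e with
  | h x y =>
    simp only [edgesWithin, Set.mem_ofPred_eq, SimpleGraph.mem_edgeSet, Sym2.mem_iff,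
      forall_eq_or_imp, forall_eq, Set.mem_image, trace]
    constructor
    · rintro ⟨hadj, hx, hy⟩
      rw [matchingUnion, SimpleGraph.fromRel_adj] at hadj
      rcases hadj.2 with h | h
      · obtain ⟨i, rfl, rfl⟩ := key x y h
        exact ⟨i, ⟨hx, hy⟩, rfl⟩
      · obtain ⟨i, rfl, rfl⟩ := key y x h
        exact ⟨i, ⟨hy, hx⟩, Sym2.eq_swap⟩
    · rintro ⟨i, ⟨h0, h1⟩, h⟩
      have hadj : (matchingUnion m 0).Adj (matchingVertexEquiv m (i, 0))
          (matchingVertexEquiv m (i, 1)) := by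
        rw [matchingUnion, SimpleGraph.fromRel_adj, Ne, Fin.ext_iff]
        simp only [matchingVertexEquiv_val]
        have := i.isLt
        simp
        omega
      rcases Sym2.eq_iff.1 h with ⟨rfl, rfl⟩ | ⟨rfl, rfl⟩
      · exact ⟨hadj, h0, h1⟩
      · exact ⟨hadj.symm, h1, h0⟩

theorem sigma1_matchingUnion_zero (m : ℕ) :
    sigma1 (matchingUnion m 0) = m * 3 ^ (m - 1) := by
  have hinj : Function.Injective fun i : Fin m =>
      s(matchingVertexEquiv m (i, 0), matchingVertexEquiv m (i, 1)) := by
    intro i j h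
    rcases Sym2.eq_iff.1 h with ⟨h, -⟩ | ⟨h, -⟩ <;>
      exact congrArg Prod.fst ((matchingVertexEquiv m).injective h)
  have hcount := card_pi_eq_exactly_once (ι := Fin m) (Set.univ : Set (Fin 2))
  rw [Fintype.card_set, Fintype.card_fin, Fintype.card_fin] at hcount
  rw [sigma1, ← show 2 ^ 2 - 1 = 3 from rfl, ← hcount]
  refine Nat.card_congr ((matchingTraceEquiv m).subtypeEquiv fun S => ?_)
  rw [Set.mem_ofPred_eq, edgesWithin_matchingUnion, Set.ncard_image_of_injective _ hinj,
    Set.mem_ofPred_eq]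

theorem mul_three_pow_lt_mul_four_pow (m : ℕ) (hm : 5 ≤ m) :
    64 * (m * 3 ^ (m - 1)) < 27 * 4 ^ m := by
  induction m, hm using Nat.le_induction with
  | base => norm_num
  | succ k hk ih =>
    obtain ⟨j, rfl⟩ : ∃ j, k = j + 1 := ⟨k - 1, by omega⟩
    simp only [Nat.add_sub_cancel, pow_succ] at ih ⊢
    nlinarith [Nat.mul_le_mul_right (3 ^ j) hk, Nat.zero_le (3 ^ j)]

/-- Let `n` be an even positive integer and let `G = (n/2)K₂` be the perfect matching on
`n` vertices. Then `σ₁(G) = (n/2)·3^{n/2−1}`; moreover, for all even `n ≥ 10`,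
`σ₁(G) < (27/64)·2ⁿ`. -/
theorem sigma1_perfect_matching (n : ℕ) (hpos : 0 < n) (heven : Even n) :
    sigma1 (matchingUnion (n / 2) 0) = n / 2 * 3 ^ (n / 2 - 1) ∧
      (10 ≤ n → (sigma1 (matchingUnion (n / 2) 0) : ℝ) < 27 / 64 * 2 ^ n) := by
  refine ⟨sigma1_matchingUnion_zero _, fun hn => ?_⟩
  have hlt := mul_three_pow_lt_mul_four_pow (n / 2) (by omega)
  rw [show 4 = 2 ^ 2 from rfl, ← pow_mul, Nat.mul_div_cancel' heven.two_dvd,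
    ← sigma1_matchingUnion_zero] at hlt
  have hlt' : (64 * sigma1 (matchingUnion (n / 2) 0) : ℝ) < 27 * 2 ^ n := by exact_mod_cast hlt
  linarith
end
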